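/- There exist constants c > 0, β > 0, C and a real number x₀ such that for all real x ≥ x₀ and every completely multiplicative function f with -1 ≤ f(n) ≤ 1 for all positive integers n, setting g(n) = ∑_{d | n} f(d) and u = ∑_{p ≤ x} (1 − f(p))/p (the sum over primes p ≤ x), one has (1/x) ∑_{n ≤ x} g(n) ≥ c · e^{−u e^{u/2}} · log x − C exp(−(log x)^{β}). -/

import Mathlib

/-- A completely multiplicative function `f : ℕ → ℝ` (on positive integers):
`f 1 = 1` and `f (m * n) = f m * f n` for all positive `m, n`. -/
def IsComplMult (f : ℕ → ℝ) : Prop :=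
  f 1 = 1 ∧ ∀ m n : ℕ, 0 < m → 0 < n → f (m * n) = f m * f n

namespace DivisorSumMean

open Finset ArithmeticFunction
open scoped ArithmeticFunction.zeta

/-- The sum of `f` over the divisors of `n`. -/
def divSum (f : ℕ → ℝ) (n : ℕ) : ℝ := ∑ d ∈ n.divisors, f d

/-- The summatory function of `divSum f`. -/
noncomputable def summatory (f : ℕ → ℝ) (x : ℝ) : ℝ := ∑ n ∈ Icc 1 ⌊x⌋₊, divSum f n

/-- The logarithmically weighted summatory function of `divSum f`. -/
noncomputable def logSummatory (f : ℕ → ℝ) (x : ℝ) : ℝ := ∑ n ∈ Icc 1 ⌊x⌋₊, divSum f n / n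

/-- The primes `p` with `z < p ≤ w`. -/
noncomputable def primesIn (z w : ℝ) : Finset ℕ :=
  {p ∈ Icc 1 ⌊w⌋₊ | p.Prime ∧ z < (p : ℝ)}

/-- The completely multiplicative functions with values in `[-1, 1]`. -/
structure IsBddComplMult (f : ℕ → ℝ) : Prop where
  map_one : f 1 = 1
  map_mul : ∀ m n : ℕ, 0 < m → 0 < n → f (m * n) = f m * f n
  neg_one_le : ∀ n : ℕ, 0 < n → -1 ≤ f n
  le_one : ∀ n : ℕ, 0 < n → f n ≤ 1

theorem mem_primesIn {z w : ℝ} {p : ℕ} :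
    p ∈ primesIn z w ↔ p.Prime ∧ z < (p : ℝ) ∧ (p : ℝ) ≤ w := by
  simp only [primesIn, mem_filter, mem_Icc]
  constructor
  · rintro ⟨⟨_, h⟩, hp, hz⟩
    exact ⟨hp, hz, (Nat.le_floor_iff' hp.ne_zero).1 h⟩
  · rintro ⟨hp, hz, h⟩
    exact ⟨⟨hp.one_le, (Nat.le_floor_iff' hp.ne_zero).2 h⟩, hp, hz⟩

theorem filter_prime_eq_primesIn (x : ℝ) :
    (Icc 1 ⌊x⌋₊).filter Nat.Prime = primesIn 1 x := by
  ext p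
  simp only [primesIn, mem_filter, and_congr_right_iff]
  intro _
  exact ⟨fun h => ⟨h, by exact_mod_cast h.one_lt⟩, fun h => h.1⟩

theorem sum_primesIn_add {a b c : ℝ} (hab : a ≤ b) (hbc : b ≤ c) (h : ℕ → ℝ) :
    ∑ p ∈ primesIn a b, h p + ∑ p ∈ primesIn b c, h p = ∑ p ∈ primesIn a c, h p := by
  rw [← sum_union]
  · congr 1
    ext p
    simp only [mem_union, mem_primesIn]
    constructor
    · rintro (⟨h1, h2, h3⟩ | ⟨h1, h2, h3⟩)
      · exact ⟨h1, h2, h3.trans hbc⟩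
      · exact ⟨h1, hab.trans_lt h2, h3⟩
    · rintro ⟨h1, h2, h3⟩
      rcases le_or_gt (p : ℝ) b with h4 | h4
      · exact Or.inl ⟨h1, h2, h4⟩
      · exact Or.inr ⟨h1, h4, h3⟩
  · rw [disjoint_left]
    intro p h1 h2
    rw [mem_primesIn] at h1 h2
    linarith [h1.2.2, h2.2.1]

theorem primesIn_subset {a b c d : ℝ} (hca : c ≤ a) (hbd : b ≤ d) :
    primesIn a b ⊆ primesIn c d := by
  intro p hp
  rw [mem_primesIn] at hp ⊢
  exact ⟨hp.1, hca.trans_lt hp.2.1, hp.2.2.trans hbd⟩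

theorem sum_range_sum_primesIn {z : ℕ → ℝ} (hz : Antitone z) (n : ℕ) (h : ℕ → ℝ) :
    ∑ j ∈ range n, ∑ p ∈ primesIn (z (j + 1)) (z j), h p = ∑ p ∈ primesIn (z n) (z 0), h p := by
  induction n with
  | zero =>
    rw [range_zero, sum_empty, sum_eq_zero]
    intro p hp
    rw [mem_primesIn] at hp
    linarith [hp.2.1, hp.2.2]
  | succ n ih =>
    rw [sum_range_succ, ih, add_comm, sum_primesIn_add (hz n.le_succ) (hz n.zero_le)]

/-- Summation over the pairs `(a, b)` with `a * b ≤ x`. -/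
theorem sum_Icc_sum_divisorsAntidiagonal (F : ℕ → ℕ → ℝ) (N : ℕ) :
    ∑ n ∈ Icc 1 N, ∑ ab ∈ n.divisorsAntidiagonal, F ab.1 ab.2 =
      ∑ b ∈ Icc 1 N, ∑ a ∈ Icc 1 (N / b), F a b := by
  rw [sum_sigma', sum_sigma']
  refine sum_bij' (fun s _ => ⟨s.2.2, s.2.1⟩) (fun s _ => ⟨s.2 * s.1, (s.2, s.1)⟩) ?_ ?_ ?_ ?_ ?_
  · rintro ⟨n, a, b⟩ hs
    simp only [mem_sigma, mem_Icc, Nat.mem_divisorsAntidiagonal] at hs ⊢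
    obtain ⟨⟨h1, h2⟩, h3, h4⟩ := hs
    have ha : 0 < a := Nat.pos_of_ne_zero (by rintro rfl; simp at h3; omega)
    have hb : 0 < b := Nat.pos_of_ne_zero (by rintro rfl; simp at h3; omega)
    refine ⟨⟨hb, ?_⟩, ha, ?_⟩
    · nlinarith
    · rw [Nat.le_div_iff_mul_le hb]; omega
  · rintro ⟨b, a⟩ hs
    simp only [mem_sigma, mem_Icc, Nat.mem_divisorsAntidiagonal] at hs ⊢
    obtain ⟨⟨h1, h2⟩, h3, h4⟩ := hs
    rw [Nat.le_div_iff_mul_le h1] at h4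
    have : 0 < a * b := Nat.mul_pos h3 h1
    exact ⟨⟨this, h4⟩, trivial, this.ne'⟩
  · rintro ⟨n, a, b⟩ hs
    simp only [mem_sigma, mem_Icc, Nat.mem_divisorsAntidiagonal] at hs
    obtain ⟨_, rfl, _⟩ := hs
    rfl
  · rintro ⟨b, a⟩ _; rfl
  · rintro ⟨n, a, b⟩ _; rfl

theorem sum_Icc_floor_sum_divisorsAntidiagonal (F : ℕ → ℕ → ℝ) (x : ℝ) :
    ∑ n ∈ Icc 1 ⌊x⌋₊, ∑ ab ∈ n.divisorsAntidiagonal, F ab.1 ab.2 =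
      ∑ b ∈ Icc 1 ⌊x⌋₊, ∑ a ∈ Icc 1 ⌊x / b⌋₊, F a b := by
  simp only [sum_Icc_sum_divisorsAntidiagonal, Nat.floor_div_natCast]

theorem sum_Icc_floor_sum_divisorsAntidiagonal' (F : ℕ → ℕ → ℝ) (x : ℝ) :
    ∑ n ∈ Icc 1 ⌊x⌋₊, ∑ ab ∈ n.divisorsAntidiagonal, F ab.1 ab.2 =
      ∑ a ∈ Icc 1 ⌊x⌋₊, ∑ b ∈ Icc 1 ⌊x / a⌋₊, F a b := by
  rw [← sum_Icc_floor_sum_divisorsAntidiagonal (fun b a => F a b)]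
  refine sum_congr rfl fun n _ => ?_
  conv_rhs => rw [← Nat.map_swap_divisorsAntidiagonal, sum_map]
  rfl

theorem divSum_one {f : ℕ → ℝ} (hf : IsBddComplMult f) : divSum f 1 = 1 := by
  simp [divSum, hf.map_one]

theorem IsBddComplMult.map_pow {f : ℕ → ℝ} (hf : IsBddComplMult f) {p : ℕ} (hp : 0 < p) (k : ℕ) :
    f (p ^ k) = f p ^ k := by
  induction k with
  | zero => simp [hf.map_one]
  | succ k ih => rw [pow_succ, hf.map_mul _ _ (pow_pos hp k) hp, ih, pow_succ]

theorem IsBddComplMult.abs_le_one {f : ℕ → ℝ} (hf : IsBddComplMult f) {n : ℕ} (hn : 0 < n) :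
    |f n| ≤ 1 := abs_le.2 ⟨hf.neg_one_le n hn, hf.le_one n hn⟩

/-- The arithmetic function attached to `f`. -/
def toArith (f : ℕ → ℝ) : ArithmeticFunction ℝ := ⟨fun n => if n = 0 then 0 else f n, by simp⟩

theorem toArith_apply (f : ℕ → ℝ) {n : ℕ} (hn : n ≠ 0) : toArith f n = f n := by
  simp [toArith, hn]

theorem toArith_mul_zeta_apply (f : ℕ → ℝ) (n : ℕ) : (toArith f * ζ) n = divSum f n := by
  rw [coe_mul_zeta_apply, divSum]
  refine sum_congr rfl fun d hd => toArith_apply f (Nat.pos_of_mem_divisors hd).ne'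

theorem isMultiplicative_toArith {f : ℕ → ℝ} (hf : IsBddComplMult f) :
    (toArith f).IsMultiplicative := by
  rw [IsMultiplicative.iff_ne_zero]
  refine ⟨by rw [toArith_apply f one_ne_zero, hf.map_one], fun {m n} hm hn _ => ?_⟩
  rw [toArith_apply f hm, toArith_apply f hn, toArith_apply f (mul_ne_zero hm hn),
    hf.map_mul _ _ (Nat.pos_of_ne_zero hm) (Nat.pos_of_ne_zero hn)]

theorem divSum_mul_of_coprime {f : ℕ → ℝ} (hf : IsBddComplMult f) {m n : ℕ}
    (hmn : m.Coprime n) : divSum f (m * n) = divSum f m * divSum f n := by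
  simp only [← toArith_mul_zeta_apply]
  exact ((isMultiplicative_toArith hf).mul isMultiplicative_zeta.natCast).map_mul_of_coprime hmn

theorem geom_sum_nonneg_of_abs_le_one {t : ℝ} (ht : |t| ≤ 1) (k : ℕ) :
    0 ≤ ∑ i ∈ range k, t ^ i := by
  rw [abs_le] at ht
  rcases eq_or_lt_of_le ht.2 with h | h
  · simp [h]
  · rw [geom_sum_eq h.ne]
    apply div_nonneg_of_nonpos _ (by linarith)
    have : |t ^ k| ≤ 1 := by
      rw [abs_pow]; exact pow_le_one₀ (abs_nonneg _) (abs_le.2 ht)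
    linarith [(abs_le.1 this).2]

theorem divSum_prime_pow {f : ℕ → ℝ} (hf : IsBddComplMult f) {p : ℕ} (hp : p.Prime) (k : ℕ) :
    divSum f (p ^ k) = ∑ i ∈ range (k + 1), f p ^ i := by
  rw [divSum, Nat.sum_divisors_prime_pow hp]
  exact sum_congr rfl fun i _ => hf.map_pow hp.pos i

theorem divSum_nonneg {f : ℕ → ℝ} (hf : IsBddComplMult f) (n : ℕ) : 0 ≤ divSum f n := by
  induction n using Nat.recOnPosPrimePosCoprime with
  | zero => simp [divSum]
  | one => simp [divSum_one hf]
  | prime_pow p k hp _ =>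
    rw [divSum_prime_pow hf hp]
    exact geom_sum_nonneg_of_abs_le_one (hf.abs_le_one hp.pos) _
  | coprime a b ha hb hab iha ihb =>
    rw [divSum_mul_of_coprime hf hab]
    exact mul_nonneg iha ihb

theorem pmul_log_mul (A B : ArithmeticFunction ℝ) :
    pmul log (A * B) = pmul log A * B + A * pmul log B := by
  ext n
  simp only [pmul_apply, mul_apply, ArithmeticFunction.add_apply, mul_sum, ← sum_add_distrib]
  refine sum_congr rfl fun ab hab => ?_
  obtain ⟨h1, h2⟩ := Nat.mem_divisorsAntidiagonal.1 hab
  rw [← h1] at h2 ⊢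
  have ha : (ab.1 : ℝ) ≠ 0 := by exact_mod_cast left_ne_zero_of_mul h2
  have hb : (ab.2 : ℝ) ≠ 0 := by exact_mod_cast right_ne_zero_of_mul h2
  rw [log_apply, log_apply, log_apply, Nat.cast_mul, Real.log_mul ha hb]
  ring

theorem pmul_toArith_mul {f : ℕ → ℝ} (hf : IsBddComplMult f) (A B : ArithmeticFunction ℝ) :
    pmul (toArith f) (A * B) = pmul (toArith f) A * pmul (toArith f) B := by
  ext n
  simp only [pmul_apply, mul_apply, mul_sum]
  refine sum_congr rfl fun ab hab => ?_
  obtain ⟨h1, h2⟩ := Nat.mem_divisorsAntidiagonal.1 hab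
  rw [← h1] at h2 ⊢
  have ha := left_ne_zero_of_mul h2
  have hb := right_ne_zero_of_mul h2
  rw [toArith_apply f h2, toArith_apply f ha, toArith_apply f hb,
    hf.map_mul _ _ (Nat.pos_of_ne_zero ha) (Nat.pos_of_ne_zero hb)]
  ring

theorem divSum_mul_log {f : ℕ → ℝ} (hf : IsBddComplMult f) (n : ℕ) :
    divSum f n * Real.log n =
      ∑ ab ∈ n.divisorsAntidiagonal, divSum f ab.1 * ((1 + f ab.2) * Λ ab.2) := by
  have h1 : pmul log (toArith f * ζ) = (toArith f * ζ) * (Λ + pmul (toArith f) Λ) := by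
    have hlog : pmul log (ζ : ArithmeticFunction ℝ) = Λ * ζ := by
      rw [vonMangoldt_mul_zeta]; ext n; by_cases hn : n = 0 <;> simp [hn]
    have hfl : pmul log (toArith f) = pmul (toArith f) Λ * toArith f := by
      have h2 : pmul (toArith f) (ζ : ArithmeticFunction ℝ) = toArith f := by
        ext n; by_cases hn : n = 0 <;> simp [hn]
      rw [← pmul_comm, ← vonMangoldt_mul_zeta, pmul_toArith_mul hf, h2]
    rw [pmul_log_mul, hlog, hfl]
    ring
  have h3 := congrArg (fun A : ArithmeticFunction ℝ => A n) h1
  simp only [pmul_apply, toArith_mul_zeta_apply, log_apply] at h3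
  rw [mul_comm, h3, mul_apply]
  refine sum_congr rfl fun ab hab => ?_
  obtain ⟨h4, h5⟩ := Nat.mem_divisorsAntidiagonal.1 hab
  rw [← h4] at h5
  rw [toArith_mul_zeta_apply, ArithmeticFunction.add_apply, pmul_apply,
    toArith_apply f (right_ne_zero_of_mul h5)]
  ring

theorem summatory_nonneg {f : ℕ → ℝ} (hf : IsBddComplMult f) (x : ℝ) : 0 ≤ summatory f x :=
  sum_nonneg fun n _ => divSum_nonneg hf n

theorem logSummatory_mono {f : ℕ → ℝ} (hf : IsBddComplMult f) : Monotone (logSummatory f) :=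
  fun _ _ hxy => sum_le_sum_of_subset_of_nonneg
    (Icc_subset_Icc_right (Nat.floor_mono hxy))
    fun n _ _ => div_nonneg (divSum_nonneg hf n) n.cast_nonneg

theorem logSummatory_nonneg {f : ℕ → ℝ} (hf : IsBddComplMult f) (x : ℝ) :
    0 ≤ logSummatory f x :=
  sum_nonneg fun n _ => div_nonneg (divSum_nonneg hf n) n.cast_nonneg

theorem one_add_nonneg {f : ℕ → ℝ} (hf : IsBddComplMult f) {n : ℕ} (hn : 0 < n) : 0 ≤ 1 + f n := by
  linarith [hf.neg_one_le n hn]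

theorem sum_divSum_mul_log {f : ℕ → ℝ} (hf : IsBddComplMult f) (x : ℝ) :
    ∑ n ∈ Icc 1 ⌊x⌋₊, divSum f n * Real.log n =
      ∑ b ∈ Icc 1 ⌊x⌋₊, (1 + f b) * Λ b * summatory f (x / b) := by
  simp only [divSum_mul_log hf, summatory, mul_sum]
  rw [sum_Icc_floor_sum_divisorsAntidiagonal (fun a b => divSum f a * ((1 + f b) * Λ b))]
  exact sum_congr rfl fun b _ => sum_congr rfl fun a _ => by ring

theorem sum_vonMangoldt_eq_psi (x : ℝ) : ∑ n ∈ Icc 1 ⌊x⌋₊, Λ n = Chebyshev.psi x := rfl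

theorem sum_divSum_mul_log_le {f : ℕ → ℝ} (hf : IsBddComplMult f) {x : ℝ} (hx : 0 ≤ x) :
    ∑ n ∈ Icc 1 ⌊x⌋₊, divSum f n * Real.log n ≤
      2 * (Real.log 4 + 4) * x * logSummatory f x := by
  simp only [divSum_mul_log hf]
  rw [sum_Icc_floor_sum_divisorsAntidiagonal' (fun a b => divSum f a * ((1 + f b) * Λ b)),
    logSummatory, mul_sum]
  refine sum_le_sum fun a _ => ?_
  rw [← mul_sum]
  have h1 : ∑ b ∈ Icc 1 ⌊x / a⌋₊, (1 + f b) * Λ b ≤ 2 * ((Real.log 4 + 4) * (x / a)) := by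
    calc ∑ b ∈ Icc 1 ⌊x / a⌋₊, (1 + f b) * Λ b ≤ ∑ b ∈ Icc 1 ⌊x / a⌋₊, 2 * Λ b := by
          refine sum_le_sum fun b hb => mul_le_mul_of_nonneg_right ?_ vonMangoldt_nonneg
          linarith [hf.le_one b (mem_Icc.1 hb).1]
      _ = 2 * Chebyshev.psi (x / a) := by rw [← mul_sum, sum_vonMangoldt_eq_psi]
      _ ≤ _ := by
          have := Chebyshev.psi_le_const_mul_self (div_nonneg hx a.cast_nonneg)
          linarith
  calc _ ≤ divSum f a * (2 * ((Real.log 4 + 4) * (x / a))) :=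
        mul_le_mul_of_nonneg_left h1 (divSum_nonneg hf a)
    _ = _ := by ring

/-- An upper bound of Hall's type for the summatory function. -/
theorem summatory_mul_log_le {f : ℕ → ℝ} (hf : IsBddComplMult f) {x : ℝ} (hx : 1 ≤ x) :
    summatory f x * Real.log x ≤ 13 * x * logSummatory f x := by
  have hx0 : 0 < x := by linarith
  have hlog4 : Real.log 4 ≤ 2 := by
    have : (4 : ℝ) = 2 ^ 2 := by norm_num
    rw [this, Real.log_pow]
    push_cast
    linarith [Real.log_two_lt_d9]
  have h1 : ∑ n ∈ Icc 1 ⌊x⌋₊, divSum f n * (Real.log x - Real.log n) ≤ x * logSummatory f x := by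
    rw [logSummatory, mul_sum]
    refine sum_le_sum fun n hn => ?_
    have hn0 : (0 : ℝ) < n := by exact_mod_cast (mem_Icc.1 hn).1
    rw [← Real.log_div hx0.ne' hn0.ne']
    have : Real.log (x / n) ≤ x / n := Real.log_le_self (by positivity)
    calc _ ≤ divSum f n * (x / n) := mul_le_mul_of_nonneg_left this (divSum_nonneg hf n)
      _ = _ := by ring
  have h2 := sum_divSum_mul_log_le hf hx0.le
  have h3 : 2 * (Real.log 4 + 4) * x * logSummatory f x ≤ 12 * x * logSummatory f x := by
    have := logSummatory_nonneg hf x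
    gcongr
    linarith
  have h4 : summatory f x * Real.log x = ∑ n ∈ Icc 1 ⌊x⌋₊, divSum f n * (Real.log x - Real.log n)
      + ∑ n ∈ Icc 1 ⌊x⌋₊, divSum f n * Real.log n := by
    rw [summatory, sum_mul, ← sum_add_distrib]
    exact sum_congr rfl fun n _ => by ring
  linarith

theorem sum_primes_mul_summatory_le {f : ℕ → ℝ} (hf : IsBddComplMult f) {x : ℝ}
    (z : ℝ) {w : ℝ} (hw : w ≤ x) :
    ∑ q ∈ primesIn z w, (1 + f q) * Real.log q * summatory f (x / q) ≤
      summatory f x * Real.log x := by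
  have h1 : ∑ n ∈ Icc 1 ⌊x⌋₊, divSum f n * Real.log n ≤ summatory f x * Real.log x := by
    rw [summatory, sum_mul]
    refine sum_le_sum fun n hn => mul_le_mul_of_nonneg_left ?_ (divSum_nonneg hf n)
    have hn1 := mem_Icc.1 hn
    exact Real.log_le_log (by exact_mod_cast hn1.1)
      ((Nat.le_floor_iff' (by omega)).1 hn1.2)
  rw [sum_divSum_mul_log hf] at h1
  refine le_trans ?_ h1
  calc _ = ∑ q ∈ primesIn z w, (1 + f q) * Λ q * summatory f (x / q) :=
        sum_congr rfl fun q hq => by rw [vonMangoldt_apply_prime (mem_primesIn.1 hq).1]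
    _ ≤ _ := by
        refine sum_le_sum_of_subset_of_nonneg ?_ fun b hb _ => ?_
        · intro q hq
          obtain ⟨hp, _, hle⟩ := mem_primesIn.1 hq
          exact mem_Icc.2 ⟨hp.one_le, (Nat.le_floor_iff' hp.ne_zero).2 (hle.trans hw)⟩
        · exact mul_nonneg (mul_nonneg (one_add_nonneg hf (mem_Icc.1 hb).1) vonMangoldt_nonneg)
            (summatory_nonneg hf _)

/-- The sum of `log p / p` over the primes `p ≤ t`. -/
noncomputable def primeLogSum (t : ℝ) : ℝ :=
  ∑ p ∈ Icc 0 ⌊t⌋₊, if p.Prime then Real.log p / p else 0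

theorem sum_Icc_ite_prime (h : ℕ → ℝ) (N : ℕ) :
    (∑ p ∈ Icc 0 N, if p.Prime then h p else 0) = ∑ p ∈ (Icc 1 N).filter Nat.Prime, h p := by
  rw [← sum_filter]
  refine sum_congr ?_ fun _ _ => rfl
  ext p
  simp only [mem_filter, mem_Icc]
  exact ⟨fun h => ⟨⟨h.2.one_le, h.1.2⟩, h.2⟩, fun h => ⟨⟨p.zero_le, h.1.2⟩, h.2⟩⟩

theorem sum_vonMangoldt_mul_div (N : ℕ) :
    ∑ n ∈ Ioc 0 N, Λ n * ((N / n : ℕ) : ℝ) = ∑ n ∈ Ioc 0 N, Real.log n := by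
  rw [← sum_Ioc_mul_zeta_eq_sum, vonMangoldt_mul_zeta]
  rfl

theorem sum_log_div_prime_le (N : ℕ) (hN : 1 ≤ N) :
    ∑ p ∈ (Icc 1 N).filter Nat.Prime, Real.log p / p ≤ Real.log N + 2 := by
  have hN0 : (0 : ℝ) < N := by exact_mod_cast hN
  have h1 : ∑ n ∈ Ioc 0 N, Real.log n ≤ N * Real.log N := by
    calc _ ≤ ∑ n ∈ Ioc 0 N, Real.log N := by
          refine sum_le_sum fun n hn => ?_
          have := mem_Ioc.1 hn
          exact Real.log_le_log (by exact_mod_cast this.1) (by exact_mod_cast this.2)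
      _ = _ := by simp
  have h2 : ∑ p ∈ (Icc 1 N).filter Nat.Prime, Real.log p * ((N / p : ℕ) : ℝ) ≤
      ∑ n ∈ Ioc 0 N, Λ n * ((N / n : ℕ) : ℝ) := by
    calc _ = ∑ p ∈ (Icc 1 N).filter Nat.Prime, Λ p * ((N / p : ℕ) : ℝ) :=
          sum_congr rfl fun p hp => by rw [vonMangoldt_apply_prime (mem_filter.1 hp).2]
      _ ≤ _ := sum_le_sum_of_subset_of_nonneg (filter_subset _ _)
          fun n _ _ => mul_nonneg vonMangoldt_nonneg (Nat.cast_nonneg _)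
  have h3 : ∑ p ∈ (Icc 1 N).filter Nat.Prime, Real.log p ≤ 2 * N := by
    have hθ := Chebyshev.theta_le_log4_mul_x (x := (N : ℝ)) hN0.le
    have h4 : Chebyshev.theta (N : ℝ) = ∑ p ∈ (Icc 1 N).filter Nat.Prime, Real.log p := by
      rw [Chebyshev.theta, Nat.floor_natCast]; rfl
    have hlog4 : Real.log 4 ≤ 2 := by
      have : (4 : ℝ) = 2 ^ 2 := by norm_num
      rw [this, Real.log_pow]
      push_cast
      linarith [Real.log_two_lt_d9]
    rw [← h4]
    nlinarith
  have h5 : N * ∑ p ∈ (Icc 1 N).filter Nat.Prime, Real.log p / p ≤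
      ∑ p ∈ (Icc 1 N).filter Nat.Prime, Real.log p * ((N / p : ℕ) : ℝ) +
      ∑ p ∈ (Icc 1 N).filter Nat.Prime, Real.log p := by
    rw [mul_sum, ← sum_add_distrib]
    refine sum_le_sum fun p hp => ?_
    have hp1 := (mem_Icc.1 (mem_filter.1 hp).1).1
    have hl : 0 ≤ Real.log p := Real.log_natCast_nonneg p
    have h6 : (N : ℝ) / p ≤ ((N / p : ℕ) : ℝ) + 1 := by
      rw [← Nat.floor_div_eq_div (K := ℝ)]
      exact (Nat.lt_floor_add_one _).le
    calc N * (Real.log p / p) = Real.log p * (N / p) := by ring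
      _ ≤ Real.log p * (((N / p : ℕ) : ℝ) + 1) := by gcongr
      _ = _ := by ring
  rw [sum_vonMangoldt_mul_div] at h2
  have h7 : N * ∑ p ∈ (Icc 1 N).filter Nat.Prime, Real.log p / p ≤ N * (Real.log N + 2) := by
    linarith
  exact le_of_mul_le_mul_left h7 hN0

theorem log_sub_one_le_sum_prime (N : ℕ) (hN : 1 ≤ N) :
    Real.log N - 1 ≤ ∑ p ∈ (Icc 1 N).filter Nat.Prime, Real.log p / (p - 1) := by
  have hN0 : (0 : ℝ) < N := by exact_mod_cast hN
  have hfac : (0 : ℝ) < N.factorial := by exact_mod_cast N.factorial_pos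
  have h1 : N * Real.log N - N ≤ Real.log N.factorial := by
    have h := Real.pow_div_factorial_le_exp (N : ℝ) hN0.le N
    have h2 := Real.log_le_log (by positivity) h
    rw [Real.log_exp, Real.log_div (by positivity) hfac.ne', Real.log_pow] at h2
    linarith
  have h2 : Real.log N.factorial ≤
      N * ∑ p ∈ (Icc 1 N).filter Nat.Prime, Real.log p / (p - 1) := by
    rw [Real.log_nat_eq_sum_factorization, mul_sum,
      Finsupp.sum_of_support_subset (s := (Icc 1 N).filter Nat.Prime) _ _ _ (by simp)]
    · refine sum_le_sum fun p hp => ?_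
      have hpp := (mem_filter.1 hp).2
      have : Fact p.Prime := ⟨hpp⟩
      have h3 := sub_one_mul_padicValNat_factorial (p := p) N
      rw [← Nat.factorization_def _ hpp] at h3
      have h4 : (p - 1) * N.factorial.factorization p ≤ N := by rw [h3]; exact Nat.sub_le _ _
      have h5 : ((p : ℝ) - 1) * N.factorial.factorization p ≤ N := by
        have := hpp.one_le
        have h6 : (((p - 1) * N.factorial.factorization p : ℕ) : ℝ) ≤ N := by exact_mod_cast h4
        rwa [Nat.cast_mul, Nat.cast_sub this, Nat.cast_one] at h6
      have h7 : (0 : ℝ) < p - 1 := by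
        have : (1 : ℝ) < p := by exact_mod_cast hpp.one_lt
        linarith
      have h8 : (N.factorial.factorization p : ℝ) ≤ N / (p - 1) := by
        rw [le_div_iff₀ h7]; linarith
      calc _ ≤ N / ((p : ℝ) - 1) * Real.log p :=
            mul_le_mul_of_nonneg_right h8 (Real.log_natCast_nonneg p)
        _ = _ := by ring
    · intro p hp
      rw [Nat.support_factorization, Nat.mem_primeFactors] at hp
      exact mem_filter.2 ⟨mem_Icc.2 ⟨hp.1.one_le, (hp.1.dvd_factorial).1 hp.2.1⟩, hp.1⟩
  have h3 : N * (Real.log N - 1) ≤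
      N * ∑ p ∈ (Icc 1 N).filter Nat.Prime, Real.log p / (p - 1) := by linarith
  exact le_of_mul_le_mul_left h3 hN0

theorem log_div_mul_sub_one_le {p : ℕ} (hp : p.Prime) :
    Real.log p / (p * (p - 1)) ≤ 4 * ((p : ℝ) ^ (3 / 2 : ℝ))⁻¹ := by
  have hp2 : (2 : ℝ) ≤ p := by exact_mod_cast hp.two_le
  have hp0 : (0 : ℝ) < p := by linarith
  have h1 : Real.log p ≤ 2 * √p := by
    have h := Real.log_le_self (Real.sqrt_nonneg (p : ℝ))
    rw [Real.log_sqrt hp0.le] at h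
    linarith
  have h2 : (p : ℝ) ^ (3 / 2 : ℝ) = p * √p := by
    rw [Real.sqrt_eq_rpow, show (3 / 2 : ℝ) = 1 + 1 / 2 by norm_num, Real.rpow_add hp0,
      Real.rpow_one]
  have hs : 0 < √(p : ℝ) := Real.sqrt_pos.2 hp0
  have hss : √(p : ℝ) * √p = p := Real.mul_self_sqrt hp0.le
  rw [h2, ← div_eq_mul_inv, div_le_div_iff₀ (by nlinarith) (by positivity)]
  calc Real.log p * (p * √p) ≤ 2 * √p * (p * √p) := by gcongr
    _ = 2 * p * (√p * √p) := by ring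
    _ = 2 * p * p := by rw [hss]
    _ ≤ 4 * (p * (p - 1)) := by nlinarith

/-- Mertens' first theorem. -/
theorem exists_abs_primeLogSum_sub_log_le :
    ∃ C : ℝ, 0 ≤ C ∧ ∀ t : ℝ, 1 ≤ t → |primeLogSum t - Real.log t| ≤ C := by
  have hsum : Summable fun n : ℕ => 4 * ((n : ℝ) ^ (3 / 2 : ℝ))⁻¹ :=
    (Real.summable_nat_rpow_inv.2 (by norm_num)).mul_left 4
  set S := ∑' n : ℕ, 4 * ((n : ℝ) ^ (3 / 2 : ℝ))⁻¹ with hS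
  have hS0 : 0 ≤ S := tsum_nonneg fun n => by positivity
  refine ⟨S + 3, by positivity, fun t ht => ?_⟩
  set N := ⌊t⌋₊ with hN
  have hN1 : 1 ≤ N := Nat.le_floor (by simpa using ht)
  have hN0 : (0 : ℝ) < N := by exact_mod_cast hN1
  have hNt : (N : ℝ) ≤ t := Nat.floor_le (by linarith)
  have htN : t ≤ 2 * N := by
    have h1 := (Nat.lt_floor_add_one t).le
    have : (1 : ℝ) ≤ N := by exact_mod_cast hN1
    rw [← hN] at h1
    linarith
  have hl1 : Real.log N ≤ Real.log t := Real.log_le_log hN0 hNt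
  have hl2 : Real.log t ≤ Real.log N + 1 := by
    have := Real.log_le_log (by linarith) htN
    rw [Real.log_mul (by norm_num) hN0.ne'] at this
    linarith [Real.log_two_lt_d9]
  have hup := sum_log_div_prime_le N hN1
  have hlow := log_sub_one_le_sum_prime N hN1
  have hdiff : ∑ p ∈ (Icc 1 N).filter Nat.Prime, Real.log p / (p - 1) ≤
      ∑ p ∈ (Icc 1 N).filter Nat.Prime, Real.log p / p + S := by
    have h1 : ∑ p ∈ (Icc 1 N).filter Nat.Prime, 4 * ((p : ℝ) ^ (3 / 2 : ℝ))⁻¹ ≤ S :=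
      hsum.sum_le_tsum _ fun n _ => by positivity
    refine le_trans ?_ (add_le_add_right h1 _)
    rw [← sum_add_distrib]
    refine sum_le_sum fun p hp => ?_
    have hpp := (mem_filter.1 hp).2
    have h2 := log_div_mul_sub_one_le hpp
    have hp2 : (2 : ℝ) ≤ p := by exact_mod_cast hpp.two_le
    have h3 : Real.log p / (p - 1) = Real.log p / p + Real.log p / (p * (p - 1)) := by
      have : (p : ℝ) - 1 ≠ 0 := by linarith
      field_simp
      ring
    linarith
  rw [primeLogSum, sum_Icc_ite_prime, abs_le]
  constructor <;> linarith

/-- The lower bound in Mertens' second theorem. -/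
theorem exists_le_sum_primesIn_inv :
    ∃ C : ℝ, 0 ≤ C ∧ ∀ z w : ℝ, 1 < z → z ≤ w →
      Real.log (Real.log w) - Real.log (Real.log z) - C / Real.log z ≤
        ∑ p ∈ primesIn z w, 1 / (p : ℝ) := by
  obtain ⟨C, hC, hA⟩ := exists_abs_primeLogSum_sub_log_le
  refine ⟨2 * C, by positivity, fun z w hz hzw => ?_⟩
  have hlog : ∀ t ∈ Set.Icc z w, 0 < Real.log t := fun t ht => Real.log_pos (hz.trans_le ht.1)
  have hpos : ∀ t ∈ Set.Icc z w, 0 < t := fun t ht => by linarith [ht.1]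
  have hderiv : ∀ t ∈ Set.Icc z w,
      HasDerivAt (fun t => (Real.log t)⁻¹) (-t⁻¹ / Real.log t ^ 2) t := fun t ht =>
    (Real.hasDerivAt_log (hpos t ht).ne').inv (hlog t ht).ne'
  have hcont : ContinuousOn (fun t : ℝ => -t⁻¹ / Real.log t ^ 2) (Set.Icc z w) := by
    refine ContinuousOn.div ?_ ?_ fun t ht => (pow_pos (hlog t ht) 2).ne'
    · exact (continuousOn_id.inv₀ fun t ht => (hpos t ht).ne').neg
    · exact (Real.continuousOn_log.mono fun t ht => (hpos t ht).ne').pow 2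
  have hderiv_int : MeasureTheory.IntegrableOn (deriv fun t => (Real.log t)⁻¹) (Set.Icc z w) :=
    (hcont.integrableOn_Icc).congr_fun (fun t ht => (hderiv t ht).deriv.symm) measurableSet_Icc
  have habel := sum_mul_eq_sub_sub_integral_mul
    (fun p : ℕ => if p.Prime then Real.log p / p else 0) (f := fun t => (Real.log t)⁻¹)
    (by linarith) hzw (fun t ht => (hderiv t ht).differentiableAt) hderiv_int
  have hlhs : ∑ k ∈ Ioc ⌊z⌋₊ ⌊w⌋₊, (Real.log k)⁻¹ * (if k.Prime then Real.log k / k else 0) =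
      ∑ p ∈ primesIn z w, 1 / (p : ℝ) := by
    simp only [mul_ite, mul_zero]
    rw [← sum_filter]
    refine sum_congr ?_ fun p hp => ?_
    · ext p
      simp only [mem_filter, mem_Ioc, primesIn, mem_Icc, Nat.floor_lt (by linarith : (0 : ℝ) ≤ z)]
      exact ⟨fun h => ⟨⟨h.2.one_le, h.1.2⟩, h.2, h.1.1⟩, fun h => ⟨⟨h.2.2, h.1.2⟩, h.2.1⟩⟩
    · have hp' := mem_primesIn.1 hp
      have := hlog p ⟨hp'.2.1.le, hp'.2.2⟩
      field_simp
  rw [hlhs] at habel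
  rw [habel]
  have hH : ∀ t ∈ Set.uIcc z w, HasDerivAt (fun t => -Real.log (Real.log t) - C * (Real.log t)⁻¹)
      (-t⁻¹ / Real.log t ^ 2 * (Real.log t - C)) t := fun t ht => by
    rw [Set.uIcc_of_le hzw] at ht
    have h1 := ((Real.hasDerivAt_log (hpos t ht).ne').log (hlog t ht).ne').neg.sub
      ((hderiv t ht).const_mul C)
    refine h1.congr_deriv ?_
    have := (hlog t ht).ne'
    have := (hpos t ht).ne'
    field_simp
    ring
  have hcont2 : ContinuousOn (fun t : ℝ => -t⁻¹ / Real.log t ^ 2 * (Real.log t - C))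
      (Set.Icc z w) :=
    hcont.mul ((Real.continuousOn_log.mono fun t ht => (hpos t ht).ne').sub continuousOn_const)
  have hcalc : ∫ t in Set.Ioc z w, -t⁻¹ / Real.log t ^ 2 * (Real.log t - C) =
      (-Real.log (Real.log w) - C * (Real.log w)⁻¹) -
        (-Real.log (Real.log z) - C * (Real.log z)⁻¹) := by
    rw [← intervalIntegral.integral_of_le hzw]
    exact intervalIntegral.integral_eq_sub_of_hasDerivAt hH
      (hcont2.intervalIntegrable_of_Icc hzw)
  have hmono : ∫ t in Set.Ioc z w, deriv (fun t => (Real.log t)⁻¹) t *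
      ∑ k ∈ Icc 0 ⌊t⌋₊, (if k.Prime then Real.log k / k else 0) ≤
      ∫ t in Set.Ioc z w, -t⁻¹ / Real.log t ^ 2 * (Real.log t - C) := by
    refine MeasureTheory.setIntegral_mono_on ?_ ?_ measurableSet_Ioc fun t ht => ?_
    · exact (integrableOn_mul_sum_Icc _ (by linarith) hderiv_int).mono_set Set.Ioc_subset_Icc_self
    · exact hcont2.integrableOn_Icc.mono_set Set.Ioc_subset_Icc_self
    · have ht' := Set.Ioc_subset_Icc_self ht
      rw [(hderiv t ht').deriv]
      refine mul_le_mul_of_nonpos_left ?_ ?_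
      · have := (abs_le.1 (hA t (hz.le.trans ht'.1))).1
        rw [primeLogSum] at this
        linarith
      · have := hpos t ht'
        have := hlog t ht'
        rw [neg_div]
        exact neg_nonpos.2 (by positivity)
  rw [hcalc] at hmono
  have hz' := hlog z ⟨le_rfl, hzw⟩
  have hw' := hlog w ⟨hzw, le_rfl⟩
  have h1 : 1 - C * (Real.log w)⁻¹ ≤ (Real.log w)⁻¹ *
      ∑ k ∈ Icc 0 ⌊w⌋₊, (if k.Prime then Real.log k / k else 0) := by
    have := (abs_le.1 (hA w (hz.le.trans hzw))).1
    rw [primeLogSum] at this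
    have h2 := mul_le_mul_of_nonneg_left (sub_le_iff_le_add.2 (by linarith) :
      Real.log w - C ≤ ∑ k ∈ Icc 0 ⌊w⌋₊, (if k.Prime then Real.log k / k else 0)) (inv_pos.2 hw').le
    rwa [mul_sub, inv_mul_cancel₀ hw'.ne', mul_comm _ C] at h2
  have h2 : (Real.log z)⁻¹ * ∑ k ∈ Icc 0 ⌊z⌋₊, (if k.Prime then Real.log k / k else 0) ≤
      1 + C * (Real.log z)⁻¹ := by
    have := (abs_le.1 (hA z hz.le)).2
    rw [primeLogSum] at this
    have h2 := mul_le_mul_of_nonneg_left (sub_le_iff_le_add'.1 this) (inv_pos.2 hz').le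
    rwa [mul_add, inv_mul_cancel₀ hz'.ne', mul_comm _ C] at h2
  rw [div_eq_mul_inv]
  linarith

theorem mul_apply_div (A B : ArithmeticFunction ℝ) (n : ℕ) :
    (A * B) n / n = ∑ ab ∈ n.divisorsAntidiagonal, A ab.1 / ab.1 * (B ab.2 / ab.2) := by
  rw [mul_apply, sum_div]
  refine sum_congr rfl fun ab hab => ?_
  rw [← (Nat.mem_divisorsAntidiagonal.1 hab).1, Nat.cast_mul, mul_div_mul_comm]

theorem sum_mul_apply_div_le {A B : ArithmeticFunction ℝ} (hA : ∀ n, 0 ≤ A n) (hB : ∀ n, 0 ≤ B n)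
    (x : ℝ) : ∑ n ∈ Icc 1 ⌊x⌋₊, (A * B) n / n ≤
      (∑ n ∈ Icc 1 ⌊x⌋₊, A n / n) * ∑ n ∈ Icc 1 ⌊x⌋₊, B n / n := by
  simp only [mul_apply_div]
  rw [sum_Icc_floor_sum_divisorsAntidiagonal' (fun a b => A a / a * (B b / b)), sum_mul_sum]
  refine sum_le_sum fun a _ => sum_le_sum_of_subset_of_nonneg ?_ fun b _ _ => ?_
  · rw [Nat.floor_div_natCast]
    exact Icc_subset_Icc_right (Nat.div_le_self _ _)
  · exact mul_nonneg (div_nonneg (hA a) a.cast_nonneg) (div_nonneg (hB b) b.cast_nonneg)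

theorem mul_sum_le_sum_mul_apply_div {A B : ArithmeticFunction ℝ} (hA : ∀ n, 0 ≤ A n)
    (hB : ∀ n, 0 ≤ B n) {x : ℝ} (hx : 0 ≤ x) :
    (∑ n ∈ Icc 1 ⌊√x⌋₊, A n / n) * ∑ n ∈ Icc 1 ⌊√x⌋₊, B n / n ≤
      ∑ n ∈ Icc 1 ⌊x⌋₊, (A * B) n / n := by
  have hnn : ∀ a b : ℕ, 0 ≤ A a / a * (B b / b) := fun a b =>
    mul_nonneg (div_nonneg (hA a) a.cast_nonneg) (div_nonneg (hB b) b.cast_nonneg)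
  simp only [mul_apply_div]
  rw [sum_Icc_floor_sum_divisorsAntidiagonal' (fun a b => A a / a * (B b / b)), sum_mul_sum]
  have hss : √x * √x = x := Real.mul_self_sqrt hx
  have hfl : ∀ a ∈ Icc 1 ⌊√x⌋₊, 1 ≤ (a : ℝ) ∧ (a : ℝ) ≤ √x := fun a ha =>
    ⟨by exact_mod_cast (mem_Icc.1 ha).1, (Nat.le_floor_iff (Real.sqrt_nonneg x)).1 (mem_Icc.1 ha).2⟩
  calc _ ≤ ∑ a ∈ Icc 1 ⌊√x⌋₊, ∑ b ∈ Icc 1 ⌊x / a⌋₊, A a / a * (B b / b) := by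
        refine sum_le_sum fun a ha => sum_le_sum_of_subset_of_nonneg ?_ fun b _ _ => hnn a b
        refine Icc_subset_Icc_right (Nat.floor_le_floor ?_)
        obtain ⟨h1, h2⟩ := hfl a ha
        rw [le_div_iff₀ (by linarith)]
        calc √x * a ≤ √x * √x := by gcongr
          _ = x := hss
    _ ≤ _ := by
        refine sum_le_sum_of_subset_of_nonneg ?_ fun a _ _ => sum_nonneg fun b _ => hnn a b
        intro a ha
        obtain ⟨h1, h2⟩ := hfl a ha
        refine mem_Icc.2 ⟨(mem_Icc.1 ha).1, (Nat.le_floor_iff hx).2 ?_⟩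
        nlinarith

theorem log_le_sum_zeta_div {y : ℝ} (hy : 0 ≤ y) :
    Real.log y ≤ ∑ n ∈ Icc 1 ⌊y⌋₊, (ζ : ArithmeticFunction ℝ) n / n := by
  refine (log_le_harmonic_floor y hy).trans_eq ?_
  rw [harmonic_eq_sum_Icc]
  push_cast
  refine sum_congr rfl fun n hn => ?_
  have hn0 : n ≠ 0 := (Nat.one_le_iff_ne_zero.1 (mem_Icc.1 hn).1)
  simp [natCoe_apply, hn0]

/-- The Dirichlet series with values `1 * (μ f)`, the convolution inverse of `f` times `1`. -/
noncomputable def zetaDivToArith (f : ℕ → ℝ) : ArithmeticFunction ℝ :=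
  ζ * pmul (toArith f) (moebius : ArithmeticFunction ℝ)

theorem divSum_mul_zetaDivToArith {f : ℕ → ℝ} (hf : IsBddComplMult f) :
    toArith f * ζ * zetaDivToArith f = (ζ : ArithmeticFunction ℝ) * ζ := by
  have h1 : toArith f * pmul (toArith f) (moebius : ArithmeticFunction ℝ) = 1 := by
    conv_lhs => enter [1]; rw [← pmul_zeta (toArith f)]
    rw [← pmul_toArith_mul hf, coe_zeta_mul_coe_moebius]
    ext n
    by_cases hn : n = 1
    · simp [hn, toArith_apply, hf.map_one]
    · simp [one_apply_ne hn]
  calc toArith f * ζ * zetaDivToArith f =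
      toArith f * pmul (toArith f) (moebius : ArithmeticFunction ℝ) * (ζ * ζ) := by
        rw [zetaDivToArith]; ring
    _ = _ := by rw [h1, one_mul]

theorem isMultiplicative_zetaDivToArith {f : ℕ → ℝ} (hf : IsBddComplMult f) :
    (zetaDivToArith f).IsMultiplicative :=
  isMultiplicative_zeta.natCast.mul ((isMultiplicative_toArith hf).pmul
    isMultiplicative_moebius.intCast)

theorem zetaDivToArith_prime_pow {f : ℕ → ℝ} (hf : IsBddComplMult f) {p : ℕ} (hp : p.Prime)
    {k : ℕ} (hk : k ≠ 0) : zetaDivToArith f (p ^ k) = 1 - f p := by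
  rw [zetaDivToArith, coe_zeta_mul_apply, Nat.sum_divisors_prime_pow hp]
  obtain ⟨k, rfl⟩ := Nat.exists_eq_succ_of_ne_zero hk
  rw [sum_range_succ', sum_range_succ']
  have h1 : ∀ i ∈ range k, (pmul (toArith f) (moebius : ArithmeticFunction ℝ)) (p ^ (i + 1 + 1)) = 0 :=
    fun i _ => by
      rw [pmul_apply, intCoe_apply, moebius_apply_prime_pow hp (by omega), if_neg (by omega)]
      simp
  rw [sum_eq_zero h1]
  simp [toArith_apply, hf.map_one, hp.ne_zero, moebius_apply_prime hp]
  ring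

theorem zetaDivToArith_nonneg {f : ℕ → ℝ} (hf : IsBddComplMult f) (n : ℕ) :
    0 ≤ zetaDivToArith f n := by
  induction n using Nat.recOnPosPrimePosCoprime with
  | zero => simp
  | one => simp [(isMultiplicative_zetaDivToArith hf).map_one]
  | prime_pow p k hp hk =>
    rw [zetaDivToArith_prime_pow hf hp hk.ne']
    linarith [hf.le_one p hp.pos]
  | coprime a b ha hb hab iha ihb =>
    rw [(isMultiplicative_zetaDivToArith hf).map_mul_of_coprime hab]
    exact mul_nonneg iha ihb

theorem hasSum_zetaDivToArith_prime_pow_div {f : ℕ → ℝ} (hf : IsBddComplMult f) {p : ℕ}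
    (hp : p.Prime) :
    HasSum (fun k : ℕ => zetaDivToArith f (p ^ k) / (p ^ k : ℕ)) (1 + (1 - f p) / (p - 1)) := by
  have hp1 : (1 : ℝ) < p := by exact_mod_cast hp.one_lt
  have h1 : HasSum (fun k : ℕ => (1 - f p) * (p : ℝ)⁻¹ * ((p : ℝ)⁻¹) ^ k)
      ((1 - f p) * (p : ℝ)⁻¹ * (1 - (p : ℝ)⁻¹)⁻¹) :=
    (hasSum_geometric_of_lt_one (by positivity) (inv_lt_one_of_one_lt₀ hp1)).mul_left _
  have h2 : (1 - f p) * (p : ℝ)⁻¹ * (1 - (p : ℝ)⁻¹)⁻¹ = (1 - f p) / (p - 1) := by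
    have : (p : ℝ) - 1 ≠ 0 := by linarith
    have : (p : ℝ) ≠ 0 := by linarith
    have : 1 - (p : ℝ)⁻¹ ≠ 0 := by
      rw [sub_ne_zero]; exact (inv_lt_one_of_one_lt₀ hp1).ne'
    field_simp
  rw [h2] at h1
  rw [add_comm, ← hasSum_nat_add_iff' 1]
  simp only [range_one, sum_singleton, pow_zero, (isMultiplicative_zetaDivToArith hf).map_one,
    Nat.cast_one, div_one, add_sub_cancel_right]
  refine h1.congr_fun fun k => ?_
  rw [zetaDivToArith_prime_pow hf hp (Nat.succ_ne_zero k)]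
  push_cast
  rw [pow_succ, inv_pow]
  field_simp

theorem sum_zetaDivToArith_div_le {f : ℕ → ℝ} (hf : IsBddComplMult f) (N : ℕ) :
    ∑ n ∈ Icc 1 N, zetaDivToArith f n / n ≤
      ∏ p ∈ (N + 1).primesBelow, (1 + (1 - f p) / (p - 1)) := by
  have hmul := isMultiplicative_zetaDivToArith hf
  set F : ℕ → ℝ := fun n => zetaDivToArith f n / n with hF
  have hF0 : ∀ n, 0 ≤ F n := fun n => div_nonneg (zetaDivToArith_nonneg hf n) n.cast_nonneg
  have h := EulerProduct.summable_and_hasSum_smoothNumbers_prod_primesBelow_tsum (f := F)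
    (by simp [hF, hmul.map_one])
    (fun {m n} hmn => by
      simp only [hF, hmul.map_mul_of_coprime hmn, Nat.cast_mul, mul_div_mul_comm])
    (fun {p} hp => (hasSum_zetaDivToArith_prime_pow_div hf hp).summable.norm) (N + 1)
  have h2 : ∏ p ∈ (N + 1).primesBelow, ∑' k : ℕ, F (p ^ k) =
      ∏ p ∈ (N + 1).primesBelow, (1 + (1 - f p) / (p - 1)) :=
    prod_congr rfl fun p hp =>
      (hasSum_zetaDivToArith_prime_pow_div hf (Nat.prime_of_mem_primesBelow hp)).tsum_eq
  rw [← h2]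
  let e : Icc 1 N → (N + 1).smoothNumbers := fun n =>
    ⟨n, Nat.mem_smoothNumbers_of_lt (mem_Icc.1 n.2).1 (Nat.lt_succ_of_le (mem_Icc.1 n.2).2)⟩
  have he : Function.Injective e := fun a b hab => Subtype.ext (congrArg (fun t : (N + 1).smoothNumbers => (t : ℕ)) hab)
  rw [← sum_coe_sort]
  calc ∑ n : Icc 1 N, F n = ∑ m ∈ univ.map ⟨e, he⟩, F m := by rw [sum_map]; rfl
    _ ≤ _ := sum_le_hasSum _ (fun m _ => hF0 m) h.2

theorem summable_inv_mul_sub_one : Summable fun n : ℕ => 2 / ((n : ℝ) * (n - 1)) := by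
  refine Summable.of_nonneg_of_le (fun n => ?_) (fun n => ?_)
    ((Real.summable_nat_pow_inv (p := 2).2 (by norm_num)).mul_left 4)
  · rcases n with _ | n
    · simp
    · push_cast
      rw [add_sub_cancel_right]
      positivity
  · rcases n with _ | _ | n
    · simp
    · simp
    · push_cast
      rw [← div_eq_mul_inv, div_le_div_iff₀ (by nlinarith [n.cast_nonneg (α := ℝ)]) (by positivity)]
      nlinarith [n.cast_nonneg (α := ℝ)]

/-- A lower bound for `logSummatory` in terms of the distance from `f` to `1`. -/
theorem exists_log_sq_le_logSummatory :
    ∃ C : ℝ, ∀ f : ℕ → ℝ, IsBddComplMult f → ∀ x : ℝ, 1 ≤ x →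
      Real.log x ^ 2 / 4 ≤
        logSummatory f x * Real.exp (∑ p ∈ primesIn 1 x, (1 - f p) / p + C) := by
  refine ⟨∑' n : ℕ, 2 / ((n : ℝ) * (n - 1)), fun f hf x hx => ?_⟩
  have hx0 : 0 ≤ x := by linarith
  have hζ : ∀ n, 0 ≤ (ζ : ArithmeticFunction ℝ) n := fun n => by
    rw [natCoe_apply]; exact Nat.cast_nonneg _
  have h1 : Real.log x ^ 2 / 4 ≤ ∑ n ∈ Icc 1 ⌊x⌋₊, ((ζ : ArithmeticFunction ℝ) * ζ) n / n := by
    refine le_trans ?_ (mul_sum_le_sum_mul_apply_div hζ hζ hx0)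
    have h2 := log_le_sum_zeta_div (Real.sqrt_nonneg x)
    have h3 : 0 ≤ Real.log x := Real.log_nonneg hx
    rw [Real.log_sqrt hx0] at h2
    nlinarith
  have hg : ∀ n, 0 ≤ (toArith f * ζ) n := fun n => by
    rw [toArith_mul_zeta_apply]; exact divSum_nonneg hf n
  have h2 := sum_mul_apply_div_le hg (zetaDivToArith_nonneg hf) x
  rw [divSum_mul_zetaDivToArith hf] at h2
  simp only [toArith_mul_zeta_apply] at h2
  have h3 : ∏ p ∈ (⌊x⌋₊ + 1).primesBelow, (1 + (1 - f p) / (p - 1)) ≤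
      Real.exp (∑ p ∈ primesIn 1 x, (1 - f p) / p + ∑' n : ℕ, 2 / ((n : ℝ) * (n - 1))) := by
    have hset : (⌊x⌋₊ + 1).primesBelow = primesIn 1 x := by
      rw [← filter_prime_eq_primesIn]
      ext p
      simp only [Nat.mem_primesBelow, mem_filter, mem_Icc, Nat.lt_succ_iff]
      exact ⟨fun h => ⟨⟨h.2.one_le, h.1⟩, h.2⟩, fun h => ⟨h.1.2, h.2⟩⟩
    rw [hset]
    have h4 : ∑ p ∈ primesIn 1 x, 2 / ((p : ℝ) * (p - 1)) ≤
        ∑' n : ℕ, 2 / ((n : ℝ) * (n - 1)) :=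
      summable_inv_mul_sub_one.sum_le_tsum _ fun n _ => by
        rcases n with _ | n
        · simp
        · push_cast
          rw [add_sub_cancel_right]
          positivity
    refine le_trans ?_ (Real.exp_le_exp.2 (add_le_add_right h4 _))
    rw [← sum_add_distrib, Real.exp_sum]
    refine prod_le_prod (fun p hp => ?_) fun p hp => ?_
    all_goals
      have hpp := (mem_primesIn.1 hp).1
      have hp1 : (1 : ℝ) < p := by exact_mod_cast hpp.one_lt
      have hfp := hf.le_one p hpp.pos
      have hfp' := hf.neg_one_le p hpp.pos
    · have : 0 ≤ (1 - f p) / (p - 1) := div_nonneg (by linarith) (by linarith)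
      linarith
    · have h5 : (1 - f p) / ((p : ℝ) - 1) ≤ (1 - f p) / p + 2 / ((p : ℝ) * (p - 1)) := by
        have h6 : (0 : ℝ) < p - 1 := by linarith
        have h7 : (1 - f p) / ((p : ℝ) - 1) = (1 - f p) / p + (1 - f p) / ((p : ℝ) * (p - 1)) := by
          field_simp
          ring
        rw [h7]
        gcongr
        linarith
      have := Real.add_one_le_exp ((1 - f p) / p + 2 / ((p : ℝ) * (p - 1)))
      linarith
  calc _ ≤ _ := h1
    _ ≤ _ := h2
    _ ≤ logSummatory f x * ∏ p ∈ (⌊x⌋₊ + 1).primesBelow, (1 + (1 - f p) / (p - 1)) :=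
        mul_le_mul_of_nonneg_left (sum_zetaDivToArith_div_le hf _) (logSummatory_nonneg hf x)
    _ ≤ _ := mul_le_mul_of_nonneg_left h3 (logSummatory_nonneg hf x)

theorem logSummatory_mul_one_add_le {f : ℕ → ℝ} (hf : IsBddComplMult f) {a b : ℝ} (ha : 0 ≤ a)
    (hb : 1 ≤ b) :
    logSummatory f a * (1 + ∑ q ∈ primesIn a b, (1 + f q) / q) ≤ logSummatory f (a * b) := by
  have hab : 0 ≤ a * b := by positivity
  have hprod : logSummatory f a * ∑ q ∈ primesIn a b, (1 + f q) / q =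
      ∑ mq ∈ Icc 1 ⌊a⌋₊ ×ˢ primesIn a b, divSum f (mq.1 * mq.2) / (mq.1 * mq.2 : ℕ) := by
    rw [logSummatory, sum_mul_sum, sum_product]
    refine sum_congr rfl fun m hm => sum_congr rfl fun q hq => ?_
    obtain ⟨hqp, haq, -⟩ := mem_primesIn.1 hq
    obtain ⟨hm1, hm2⟩ := mem_Icc.1 hm
    have hma : (m : ℝ) ≤ a := (Nat.le_floor_iff ha).1 hm2
    have hmq : m < q := by exact_mod_cast hma.trans_lt haq
    have hcop : m.Coprime q :=
      ((Nat.Prime.coprime_iff_not_dvd hqp).2 fun h => by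
        have := Nat.le_of_dvd hm1 h; omega).symm
    have hdq : divSum f q = 1 + f q := by
      have := divSum_prime_pow hf hqp 1
      rw [pow_one] at this
      rw [this]
      simp [sum_range_succ]
    rw [divSum_mul_of_coprime hf hcop, hdq, Nat.cast_mul, mul_div_mul_comm]
  have hinj : Set.InjOn (fun mq : ℕ × ℕ => mq.1 * mq.2) (Icc 1 ⌊a⌋₊ ×ˢ primesIn a b : Finset _) := by
    rintro ⟨m, q⟩ h1 ⟨m', q'⟩ h2 h3
    simp only [coe_product, Set.mem_prod, mem_coe, mem_Icc, mem_primesIn, Nat.le_floor_iff ha]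
      at h1 h2 h3
    obtain ⟨⟨hm1, hma⟩, hq, haq, -⟩ := h1
    obtain ⟨⟨hm1', hma'⟩, hq', haq', -⟩ := h2
    have hqq : q = q' := by
      have hdvd : q ∣ m' * q' := ⟨m, by rw [← h3]; ring⟩
      rcases (Nat.Prime.dvd_mul hq).1 hdvd with h | h
      · exfalso
        have h4 : (q : ℝ) ≤ m' := by exact_mod_cast Nat.le_of_dvd hm1' h
        linarith
      · exact (Nat.prime_dvd_prime_iff_eq hq hq').1 h
    subst hqq
    exact Prod.ext (Nat.eq_of_mul_eq_mul_right hq.pos h3) rfl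
  rw [mul_add, mul_one, hprod, ← sum_image (f := fun n : ℕ => divSum f n / n) hinj, logSummatory,
    ← sum_union]
  · refine sum_le_sum_of_subset_of_nonneg (union_subset ?_ ?_) fun n _ _ =>
      div_nonneg (divSum_nonneg hf n) n.cast_nonneg
    · exact Icc_subset_Icc_right (Nat.floor_le_floor (by nlinarith))
    · intro n hn
      obtain ⟨⟨m, q⟩, hmq, rfl⟩ := mem_image.1 hn
      simp only [mem_product, mem_Icc, mem_primesIn, Nat.le_floor_iff ha] at hmq
      obtain ⟨⟨hm1, hma⟩, hq, -, hqb⟩ := hmq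
      refine mem_Icc.2 ⟨Nat.mul_pos hm1 hq.pos, (Nat.le_floor_iff hab).2 ?_⟩
      push_cast
      gcongr
  · rw [disjoint_left]
    intro n hn hn'
    obtain ⟨⟨m, q⟩, hmq, rfl⟩ := mem_image.1 hn'
    simp only [mem_product, mem_Icc, mem_primesIn, Nat.le_floor_iff ha] at hmq hn
    obtain ⟨⟨hm1, hma⟩, hq, haq, -⟩ := hmq
    have h1 : q ≤ m * q := Nat.le_mul_of_pos_left q hm1
    have h2 : (q : ℝ) ≤ (m * q : ℕ) := by exact_mod_cast h1
    linarith [hn.2]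

theorem exists_div_four_le_theta : ∃ T : ℝ, 2 ≤ T ∧ ∀ v : ℝ, T ≤ v → v / 4 ≤ Chebyshev.theta v := by
  obtain ⟨C, hC⟩ := Chebyshev.psi_sub_theta_le_mul_sqrt
  set B := max C 0 with hB
  have hB0 : 0 ≤ B := le_max_right _ _
  refine ⟨(3 * (B + 5)) ^ 2, by nlinarith, fun v hv => ?_⟩
  have hv1 : 1 ≤ v := by nlinarith
  have hs : 3 * (B + 5) ≤ √v := Real.le_sqrt_of_sq_le hv
  have hss : √v * √v = v := Real.mul_self_sqrt (by linarith)
  have h1 := Chebyshev.psi_ge' (x := v) (by linarith)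
  have h2 : Chebyshev.psi v - Chebyshev.theta v ≤ B * √v :=
    (hC v).trans (mul_le_mul_of_nonneg_right (le_max_left _ _) (Real.sqrt_nonneg v))
  have h3 : Real.log (v + 2) ≤ 4 * √v := by
    have h4 := Real.log_le_self (Real.sqrt_nonneg (v + 2))
    rw [Real.log_sqrt (by linarith)] at h4
    have h5 : √(v + 2) ≤ 2 * √v := by
      rw [Real.sqrt_le_left (by positivity), mul_pow, sq (√v), hss]
      linarith
    linarith
  nlinarith [Real.log_two_gt_d9]

theorem sum_primesIn_log_eq {t v : ℝ} (htv : t ≤ v) :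
    ∑ q ∈ primesIn t v, Real.log q = Chebyshev.theta v - Chebyshev.theta t := by
  have h : ∀ s, Chebyshev.theta s = ∑ p ∈ primesIn 1 s, Real.log p := fun s => by
    rw [← filter_prime_eq_primesIn]; rfl
  rcases le_or_gt 1 t with ht | ht
  · rw [h, h, ← sum_primesIn_add ht htv]
    ring
  · rw [h, Chebyshev.theta_eq_zero_of_le_one ht.le, sub_zero]
    refine sum_congr ?_ fun _ _ => rfl
    ext p
    simp only [mem_primesIn]
    refine ⟨fun h => ⟨h.1, by exact_mod_cast h.1.one_lt, h.2.2⟩, fun h => ⟨h.1, ?_, h.2.2⟩⟩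
    linarith [h.2.1]

theorem logSummatory_div_ge {f : ℕ → ℝ} (hf : IsBddComplMult f) {t : ℝ} (ht : 0 < t)
    (hlog : 832 ≤ Real.log t) : 3 / 4 * logSummatory f t ≤ logSummatory f (t / 16) := by
  have ht1 : 1 ≤ t := by
    by_contra! h
    linarith [Real.log_nonpos ht.le h.le]
  have hM := summatory_mul_log_le hf ht1
  have hdiff : logSummatory f t ≤ logSummatory f (t / 16) + 16 / t * summatory f t := by
    have hsub : Icc 1 ⌊t / 16⌋₊ ⊆ Icc 1 ⌊t⌋₊ :=
      Icc_subset_Icc_right (Nat.floor_le_floor (by linarith))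
    rw [logSummatory, logSummatory, ← sum_sdiff hsub, add_comm]
    gcongr
    rw [summatory, mul_sum]
    refine le_trans (sum_le_sum fun n hn => ?_) (sum_le_sum_of_subset_of_nonneg sdiff_subset
      fun n _ _ => mul_nonneg (by positivity) (divSum_nonneg hf n))
    rw [mem_sdiff, mem_Icc, mem_Icc, not_and] at hn
    have hn1 : t / 16 < n := (Nat.floor_lt (by positivity)).1 (not_le.1 (hn.2 hn.1.1))
    have hn0 : (0 : ℝ) < n := by exact_mod_cast hn.1.1
    rw [div_eq_mul_inv, mul_comm]
    refine mul_le_mul_of_nonneg_right ?_ (divSum_nonneg hf n)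
    rw [inv_eq_one_div, div_le_div_iff₀ hn0 ht]
    linarith
  have hL := logSummatory_nonneg hf t
  have hM2 : summatory f t ≤ t * logSummatory f t / 64 := by
    have h0 := summatory_nonneg hf t
    nlinarith
  have : 16 / t * summatory f t ≤ logSummatory f t / 4 := by
    calc 16 / t * summatory f t ≤ 16 / t * (t * logSummatory f t / 64) := by gcongr
      _ = _ := by field_simp; ring
  linarith

theorem sum_primesIn_log_mul_summatory_ge {f : ℕ → ℝ} (hf : IsBddComplMult f) {T a w t y : ℝ}
    (hT : ∀ v, T ≤ v → v / 4 ≤ Chebyshev.theta v) (ht : 0 < t) (hTt : T ≤ t) (hty : t * t = y)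
    (haw : a * w = y) (ha : 0 < a) :
    y / 8 * (logSummatory f (t / 16) - logSummatory f a) ≤
      ∑ q ∈ primesIn t w, Real.log q * summatory f (y / q) := by
  have hy : 0 < y := by rw [← hty]; positivity
  set S := (Icc 1 ⌊t / 16⌋₊).filter fun m : ℕ => a < m with hS
  have h1 : logSummatory f (t / 16) - logSummatory f a ≤ ∑ m ∈ S, divSum f m / m := by
    rw [sub_le_iff_le_add, logSummatory, logSummatory,
      ← sum_filter_add_sum_filter_not (Icc 1 ⌊t / 16⌋₊) fun m : ℕ => a < m]
    refine add_le_add le_rfl (sum_le_sum_of_subset_of_nonneg ?_ fun n _ _ =>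
      div_nonneg (divSum_nonneg hf n) n.cast_nonneg)
    intro m hm
    simp only [mem_filter, mem_Icc, not_lt] at hm
    exact mem_Icc.2 ⟨hm.1.1, (Nat.le_floor_iff ha.le).2 hm.2⟩
  calc _ ≤ y / 8 * ∑ m ∈ S, divSum f m / m := mul_le_mul_of_nonneg_left h1 (by positivity)
    _ ≤ ∑ m ∈ S, ∑ q ∈ primesIn t w, if (m : ℝ) ≤ y / q then Real.log q * divSum f m else 0 := by
        rw [mul_sum]
        refine sum_le_sum fun m hm => ?_
        obtain ⟨hm1, ham⟩ := mem_filter.1 hm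
        obtain ⟨hm1, hmt⟩ := mem_Icc.1 hm1
        have hm0 : (0 : ℝ) < m := by exact_mod_cast hm1
        have hmt : (m : ℝ) ≤ t / 16 := (Nat.le_floor_iff (by positivity)).1 hmt
        set v := y / m with hv
        have hvm : v * m = y := div_mul_cancel₀ _ hm0.ne'
        have hvt : 16 * t ≤ v := by
          rw [hv, le_div_iff₀ hm0, ← hty]
          nlinarith
        have hvw : v ≤ w := by
          rw [hv, div_le_iff₀ hm0, ← haw, mul_comm]
          have hw : 0 < w := by
            by_contra! h
            nlinarith
          gcongr
        have hlog : v / 8 ≤ ∑ q ∈ primesIn t v, Real.log q := by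
          rw [sum_primesIn_log_eq (by linarith)]
          have h2 := hT v (by linarith)
          have h3 := Chebyshev.theta_le_log4_mul_x ht.le
          have h4 : Real.log 4 ≤ 2 := by
            rw [show (4 : ℝ) = 2 ^ 2 by norm_num, Real.log_pow]
            push_cast
            linarith [Real.log_two_lt_d9]
          nlinarith
        calc y / 8 * (divSum f m / m) = v / 8 * divSum f m := by rw [hv]; ring
          _ ≤ (∑ q ∈ primesIn t v, Real.log q) * divSum f m :=
              mul_le_mul_of_nonneg_right hlog (divSum_nonneg hf m)
          _ = ∑ q ∈ primesIn t v,
                if (m : ℝ) ≤ y / q then Real.log q * divSum f m else 0 := by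
              rw [sum_mul]
              refine sum_congr rfl fun q hq => ?_
              obtain ⟨hqp, -, hqv⟩ := mem_primesIn.1 hq
              have hq0 : (0 : ℝ) < q := by exact_mod_cast hqp.pos
              rw [if_pos]
              rw [le_div_iff₀ hq0, ← hvm, mul_comm]
              gcongr
          _ ≤ _ := by
              refine sum_le_sum_of_subset_of_nonneg (primesIn_subset le_rfl hvw) fun q _ _ => ?_
              split_ifs
              · exact mul_nonneg (Real.log_natCast_nonneg q) (divSum_nonneg hf m)
              · exact le_rfl
    _ ≤ _ := by
        rw [sum_comm]
        refine sum_le_sum fun q hq => ?_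
        have hyq : 0 ≤ y / q := div_nonneg hy.le q.cast_nonneg
        rw [← sum_filter, summatory, mul_sum]
        refine sum_le_sum_of_subset_of_nonneg ?_ fun m _ _ =>
          mul_nonneg (Real.log_natCast_nonneg q) (divSum_nonneg hf m)
        intro m hm
        obtain ⟨hmS, hmq⟩ := mem_filter.1 hm
        exact mem_Icc.2 ⟨(mem_Icc.1 (mem_filter.1 hmS).1).1, (Nat.le_floor_iff hyq).2 hmq⟩

theorem sum_primesIn_one_sub_mul_log_mul_summatory_le {f : ℕ → ℝ} (hf : IsBddComplMult f)
    {η a w t y : ℝ} (hη : 0 < η) (ht : 1 ≤ t) (hty : t * t = y)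
    (haw : a * w = y) (ha : 1 ≤ a) (hw : 0 < w) (hlog : η * Real.log y ≤ Real.log a) :
    ∑ q ∈ primesIn t w, (1 - f q) * Real.log q * summatory f (y / q) ≤
      13 / η * y * logSummatory f t * ∑ q ∈ primesIn t w, (1 - f q) / q := by
  have hy : 1 ≤ y := by rw [← hty]; nlinarith
  rw [mul_sum]
  refine sum_le_sum fun q hq => ?_
  obtain ⟨hqp, htq, hqw⟩ := mem_primesIn.1 hq
  have hq0 : (0 : ℝ) < q := by linarith
  have hayq : a ≤ y / q := by
    rw [le_div_iff₀ hq0, ← haw]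
    gcongr
  have hyqt : y / q ≤ t := by
    rw [div_le_iff₀ hq0, ← hty]
    gcongr
  have hqy : Real.log q ≤ Real.log y := by
    refine Real.log_le_log hq0 ?_
    rw [← haw]
    nlinarith
  have h1 := summatory_mul_log_le hf (ha.trans hayq)
  have h2 : η * Real.log q ≤ Real.log (y / q) := by
    have := Real.log_le_log (by linarith) hayq
    nlinarith
  have hM := summatory_nonneg hf (y / q)
  have h3 : η * (Real.log q * summatory f (y / q)) ≤ 13 * (y / q) * logSummatory f t := by
    calc η * (Real.log q * summatory f (y / q)) = summatory f (y / q) * (η * Real.log q) := by ring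
      _ ≤ summatory f (y / q) * Real.log (y / q) := by gcongr
      _ ≤ 13 * (y / q) * logSummatory f (y / q) := h1
      _ ≤ _ := by
        gcongr
        exact logSummatory_mono hf hyqt
  have h4 : Real.log q * summatory f (y / q) ≤ 13 / η * (y / q) * logSummatory f t := by
    have h5 : 13 / η * (y / q) * logSummatory f t = 13 * (y / q) * logSummatory f t / η := by ring
    rw [h5, le_div_iff₀ hη]
    linarith
  have h5 : 0 ≤ 1 - f q := by linarith [hf.le_one q hqp.pos]
  calc _ = (1 - f q) * (Real.log q * summatory f (y / q)) := by ring
    _ ≤ (1 - f q) * (13 / η * (y / q) * logSummatory f t) := by gcongr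
    _ = _ := by ring

theorem exists_two_mul_logSummatory_le {η : ℝ} (hη : 0 < η) (hη' : η ≤ 1 / 10) :
    ∃ ℓ₀ : ℝ, 0 ≤ ℓ₀ ∧ ∀ f : ℕ → ℝ, IsBddComplMult f → ∀ y : ℝ, 1 ≤ y → ℓ₀ ≤ Real.log y →
      ∑ p ∈ primesIn (y ^ η) (y ^ (1 - η)), (1 - f p) / p ≤ 1 / 2 →
      2 * logSummatory f (y ^ η) ≤ logSummatory f (√y) := by
  obtain ⟨C, hC, hmertens⟩ := exists_le_sum_primesIn_inv
  refine ⟨1 + 2 * C / η, by positivity, fun f hf y hy hℓ hε => ?_⟩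
  have hy0 : 0 < y := by linarith
  set ℓ := Real.log y with hℓdef
  have hCη : 0 ≤ 2 * C / η := by positivity
  have hℓ0 : 0 < ℓ := by linarith
  set t := √y with ht
  set a := y ^ η with ha
  have hloga : Real.log a = η * ℓ := Real.log_rpow hy0 η
  have ha1 : 1 < a := (Real.log_pos_iff (Real.rpow_nonneg hy0.le _)).1 (by rw [hloga]; positivity)
  set b := y ^ (1 / 2 - η) with hb
  have hab : a * b = t := by
    rw [ha, hb, ← Real.rpow_add hy0, ht, Real.sqrt_eq_rpow]
    congr 1
    ring
  have hlogb : Real.log b = (1 / 2 - η) * ℓ := Real.log_rpow hy0 _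
  have hab' : a ≤ b := Real.rpow_le_rpow_of_exponent_le hy (by linarith)
  have h1 := logSummatory_mul_one_add_le hf (a := a) (b := b) (by linarith) (by linarith)
  rw [hab] at h1
  have h2 := hmertens a b ha1 hab'
  have h3 : 1.38 ≤ Real.log (Real.log b) - Real.log (Real.log a) := by
    have h4 : Real.log 4 ≤ Real.log (Real.log b / Real.log a) := by
      refine Real.log_le_log (by norm_num) ?_
      rw [hlogb, hloga, le_div_iff₀ (by positivity)]
      nlinarith
    rw [Real.log_div (by rw [hlogb]; nlinarith) (by rw [hloga]; positivity),
      show (4 : ℝ) = 2 ^ 2 by norm_num, Real.log_pow] at h4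
    push_cast at h4
    linarith [Real.log_two_gt_d9]
  have h4 : C / Real.log a ≤ 1 / 2 := by
    rw [hloga, div_le_iff₀ (by positivity)]
    have : 2 * C ≤ ℓ * η := (div_le_iff₀ hη).1 (by linarith)
    nlinarith
  have h5 : ∑ q ∈ primesIn a b, (1 - f q) / q ≤ 1 / 2 := by
    refine le_trans (sum_le_sum_of_subset_of_nonneg (primesIn_subset le_rfl ?_)
      fun p hp _ => ?_) hε
    · exact Real.rpow_le_rpow_of_exponent_le hy (by linarith)
    · exact div_nonneg (by linarith [hf.le_one p (mem_primesIn.1 hp).1.pos]) p.cast_nonneg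
  have h6 : ∑ q ∈ primesIn a b, (1 + f q) / q =
      2 * ∑ q ∈ primesIn a b, 1 / (q : ℝ) - ∑ q ∈ primesIn a b, (1 - f q) / q := by
    rw [mul_sum, ← sum_sub_distrib]
    exact sum_congr rfl fun q _ => by ring
  have h7 : 1 ≤ ∑ q ∈ primesIn a b, (1 + f q) / q := by
    rw [h6]
    linarith
  have := logSummatory_nonneg hf a
  nlinarith

/-- If `f` is close to `1` on the primes in `(y ^ η, y ^ (1 - η)]`, then the mean value of
`divSum f` up to `y` is as large as one would expect. -/
theorem exists_mul_logSummatory_le_summatory {η : ℝ} (hη : 0 < η) (hη' : η ≤ 1 / 10) :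
    ∃ ε ℓ₀ : ℝ, 0 < ε ∧ ∀ f : ℕ → ℝ, IsBddComplMult f → ∀ y : ℝ, 1 ≤ y → ℓ₀ ≤ Real.log y →
      ∑ p ∈ primesIn (y ^ η) (y ^ (1 - η)), (1 - f p) / p ≤ ε →
      y * logSummatory f (√y) / 32 ≤ summatory f y * Real.log y := by
  obtain ⟨ℓ₁, hℓ₁0, hℓ₁⟩ := exists_two_mul_logSummatory_le hη hη'
  obtain ⟨T, hT2, hT⟩ := exists_div_four_le_theta
  refine ⟨η / 416, 1664 + 2 * T + ℓ₁, by positivity, fun f hf y hy hℓ hε => ?_⟩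
  have hy0 : 0 < y := by linarith
  set ℓ := Real.log y with hℓdef
  have hℓ0 : 1664 ≤ ℓ := by linarith
  set t := √y with ht
  have hlogt : Real.log t = ℓ / 2 := Real.log_sqrt hy0.le
  have ht0 : 0 < t := Real.sqrt_pos.2 hy0
  have hty : t * t = y := Real.mul_self_sqrt hy0.le
  have ht1 : 1 ≤ t := Real.one_le_sqrt.2 hy
  have hTt : T ≤ t := by
    rw [← Real.exp_log ht0, hlogt]
    linarith [Real.add_one_le_exp (ℓ / 2)]
  set a := y ^ η with ha
  set w := y ^ (1 - η) with hw
  have hw0 : 0 < w := Real.rpow_pos_of_pos hy0 _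
  have haw : a * w = y := by
    rw [ha, hw, ← Real.rpow_add hy0]
    simp
  have hloga : Real.log a = η * ℓ := Real.log_rpow hy0 η
  have ha1 : 1 < a := (Real.log_pos_iff (Real.rpow_nonneg hy0.le _)).1 (by rw [hloga]; positivity)
  have htw : t ≤ w := by
    rw [ht, Real.sqrt_eq_rpow]
    exact Real.rpow_le_rpow_of_exponent_le hy (by linarith)
  have hsplit : ∑ q ∈ primesIn t w, (1 - f q) / q ≤ η / 416 := by
    refine le_trans ?_ hε
    refine sum_le_sum_of_subset_of_nonneg (primesIn_subset ?_ le_rfl) fun p hp _ => ?_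
    · rw [ht, Real.sqrt_eq_rpow]
      exact Real.rpow_le_rpow_of_exponent_le hy (by linarith)
    · exact div_nonneg (by linarith [hf.le_one p (mem_primesIn.1 hp).1.pos]) p.cast_nonneg
  have hL := logSummatory_nonneg hf t
  have hLa : 2 * logSummatory f a ≤ logSummatory f t :=
    hℓ₁ f hf y hy (by linarith) (hε.trans (by linarith))
  have hL16 := logSummatory_div_ge hf ht0 (by rw [hlogt]; linarith)
  have hmain := sum_primesIn_log_mul_summatory_ge hf hT ht0 hTt hty haw (by linarith)
  have herr := sum_primesIn_one_sub_mul_log_mul_summatory_le hf hη ht1 hty haw ha1.le hw0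
    hloga.ge
  have herr2 : 13 / η * y * logSummatory f t * ∑ q ∈ primesIn t w, (1 - f q) / q ≤
      y * logSummatory f t / 32 := by
    calc _ ≤ 13 / η * y * logSummatory f t * (η / 416) := by gcongr
      _ = _ := by field_simp; ring
  have hlow := sum_primes_mul_summatory_le hf t (w := w) (x := y) (by nlinarith)
  have heq : ∑ q ∈ primesIn t w, (1 + f q) * Real.log q * summatory f (y / q) =
      2 * ∑ q ∈ primesIn t w, Real.log q * summatory f (y / q) -
        ∑ q ∈ primesIn t w, (1 - f q) * Real.log q * summatory f (y / q) := by
    rw [mul_sum, ← sum_sub_distrib]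
    exact sum_congr rfl fun q _ => by ring
  have h1 : y / 8 * (logSummatory f t / 4) ≤
      y / 8 * (logSummatory f (t / 16) - logSummatory f a) := by
    gcongr
    linarith
  rw [heq] at hlow
  linarith

theorem summatory_ge_of_primesIn_aux {f : ℕ → ℝ} (hf : IsBddComplMult f)
    {z' z A B Y c θ R : ℝ} (hz' : 1 < z') (hz : z' ≤ z) (hA : 1 ≤ A) (hAB : A ≤ B) (hc : 0 ≤ c)
    (hθ : 0 < θ) (hθsum : θ ≤ ∑ q ∈ primesIn z' z, (1 + f q) / q) (hθR : θ ≤ R)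
    (hR : Real.log Y ≤ R * Real.log z')
    (hbase : ∀ y, A ≤ y → y ≤ z * B → c * y ≤ summatory f y) (n : ℕ) :
    ∀ y, A ≤ y → y ≤ Y → y ≤ z * B * z' ^ n → c * (θ / R) ^ n * y ≤ summatory f y := by
  have hR0 : 0 < R := by linarith
  have hr0 : 0 ≤ θ / R := by positivity
  have hr1 : θ / R ≤ 1 := (div_le_one hR0).2 hθR
  have hz0 : 0 < z := by linarith
  have hlogz' := Real.log_pos hz'
  induction n with
  | zero =>
    intro y hAy _ hy
    simpa using hbase y hAy (by simpa using hy)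
  | succ n ih =>
    intro y hAy hyY hy
    rcases le_or_gt y (z * B) with hyB | hyB
    · refine le_trans ?_ (hbase y hAy hyB)
      have : (θ / R) ^ (n + 1) ≤ 1 := pow_le_one₀ hr0 hr1
      have hy0 : 0 ≤ y := by linarith
      calc c * (θ / R) ^ (n + 1) * y ≤ c * 1 * y := by gcongr
        _ = c * y := by ring
    have hzy : z ≤ y := by nlinarith
    have hy0 : 0 < y := by linarith
    have hlogy : 0 < Real.log y := Real.log_pos (by linarith)
    have hlogyR : Real.log y ≤ R * Real.log z' := (Real.log_le_log hy0 hyY).trans hR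
    have hsum := sum_primes_mul_summatory_le hf z' hzy
    have hlow : ∑ q ∈ primesIn z' z, (1 + f q) / q * (c * (θ / R) ^ n * y * Real.log z') ≤
        ∑ q ∈ primesIn z' z, (1 + f q) * Real.log q * summatory f (y / q) := by
      refine sum_le_sum fun q hq => ?_
      obtain ⟨hqp, hzq, hqz⟩ := mem_primesIn.1 hq
      have hq0 : (0 : ℝ) < q := by linarith
      have h1 : B ≤ y / q := by
        rw [le_div_iff₀ hq0]
        nlinarith
      have h2 : y / q ≤ y / z' := by gcongr
      have h3 : y / z' ≤ z * B * z' ^ n := by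
        rw [div_le_iff₀ (by linarith), mul_assoc, ← pow_succ]
        exact hy
      have h4 : y / q ≤ y := div_le_self hy0.le (by linarith)
      have h5 := ih (y / q) (hAB.trans h1) (h4.trans hyY) (h2.trans h3)
      have h6 := one_add_nonneg hf hqp.pos
      have h7 : Real.log z' ≤ Real.log q := Real.log_le_log (by linarith) hzq.le
      calc (1 + f q) / q * (c * (θ / R) ^ n * y * Real.log z') =
          (1 + f q) * Real.log z' * (c * (θ / R) ^ n * (y / q)) := by ring
        _ ≤ _ := by gcongr
    rw [← sum_mul] at hlow
    have h8 : c * (θ / R) ^ (n + 1) * y * Real.log y ≤ summatory f y * Real.log y := by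
      refine le_trans ?_ (hlow.trans hsum)
      calc c * (θ / R) ^ (n + 1) * y * Real.log y ≤
          c * (θ / R) ^ (n + 1) * y * (R * Real.log z') := by gcongr
        _ = θ * (c * (θ / R) ^ n * y * Real.log z') := by
          rw [pow_succ]
          field_simp
        _ ≤ _ := by gcongr
    exact le_of_mul_le_mul_right h8 hlogy

/-- Propagation of a lower bound for `summatory` from a short range to a long one, using the
primes in `(z', z]`. -/
theorem summatory_ge_of_primesIn {f : ℕ → ℝ} (hf : IsBddComplMult f)
    {z' z A B Y c θ R : ℝ} (hz' : 1 < z') (hz : z' ≤ z) (hA : 1 ≤ A) (hAB : A ≤ B) (hc : 0 ≤ c)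
    (hθ : 0 < θ) (hθsum : θ ≤ ∑ q ∈ primesIn z' z, (1 + f q) / q) (hθR : θ ≤ R)
    (hR : Real.log Y ≤ R * Real.log z')
    (hbase : ∀ y, A ≤ y → y ≤ z * B → c * y ≤ summatory f y) {y : ℝ} (hAy : A ≤ y) (hyY : y ≤ Y) :
    c * Real.exp (-(R * Real.log (R / θ))) * y ≤ summatory f y := by
  have hR0 : 0 < R := by linarith
  have hr0 : 0 < θ / R := by positivity
  have hr1 : θ / R ≤ 1 := (div_le_one hR0).2 hθR
  have hlogz' := Real.log_pos hz'
  have hY : 0 < Y := by linarith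
  have hYn : Y ≤ z * B * z' ^ ⌊R⌋₊ := by
    have h1 : Y ≤ z' ^ (⌊R⌋₊ + 1) := by
      rw [← Real.log_le_log_iff hY (by positivity), Real.log_pow]
      refine hR.trans ?_
      push_cast
      gcongr
      exact (Nat.lt_floor_add_one R).le
    rw [pow_succ, mul_comm] at h1
    refine h1.trans ?_
    gcongr
    nlinarith
  refine le_trans ?_ (summatory_ge_of_primesIn_aux hf hz' hz hA hAB hc hθ hθsum hθR hR hbase ⌊R⌋₊ y
    hAy hyY (hyY.trans hYn))
  have h2 : Real.exp (-(R * Real.log (R / θ))) ≤ (θ / R) ^ ⌊R⌋₊ := by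
    rw [← Real.rpow_natCast, Real.rpow_def_of_pos hr0]
    refine Real.exp_le_exp.2 ?_
    have h3 : Real.log (R / θ) = -Real.log (θ / R) := by rw [← Real.log_inv, inv_div]
    rw [h3]
    have h4 : Real.log (θ / R) ≤ 0 := Real.log_nonpos hr0.le hr1
    have h5 := Nat.floor_le hR0.le
    nlinarith
  have : 0 ≤ y := by linarith
  gcongr

/-- The number of `j ∈ [i, N)` for which `f` is close to `-1` on the primes in
`(exp (ℓ / K ^ (j + 1)), exp (ℓ / K ^ j)]`. -/
noncomputable def badCount (f : ℕ → ℝ) (K ℓ θ : ℝ) (N i : ℕ) : ℕ :=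
  #{j ∈ Ico i N | ∑ q ∈ primesIn (Real.exp (ℓ / K ^ (j + 1))) (Real.exp (ℓ / K ^ j)),
    (1 + f q) / q < θ}

theorem badCount_add_le {f : ℕ → ℝ} {K ℓ θ : ℝ} {N i j : ℕ} (hij : i < j) (hjN : j ≤ N)
    (h : ∀ k, i < k → k < j →
      ∑ q ∈ primesIn (Real.exp (ℓ / K ^ (k + 1))) (Real.exp (ℓ / K ^ k)), (1 + f q) / q < θ) :
    badCount f K ℓ θ N j + (j - (i + 1)) ≤ badCount f K ℓ θ N i := by
  rw [badCount, badCount, ← Nat.card_Ico (i + 1) j, ← card_union_of_disjoint]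
  · refine card_le_card fun k hk => ?_
    simp only [mem_union, mem_filter, mem_Ico] at hk ⊢
    rcases hk with hk | hk
    · exact ⟨⟨by omega, hk.1.2⟩, hk.2⟩
    · exact ⟨⟨by omega, by omega⟩, h k (by omega) hk.2⟩
  · rw [disjoint_left]
    intro k hk hk'
    simp only [mem_filter, mem_Ico] at hk hk'
    omega

theorem exists_first_good {P : ℕ → Prop} {i N : ℕ} (hiN : i < N) (hN : P N) :
    ∃ j, i < j ∧ j ≤ N ∧ P j ∧ ∀ k, i < k → k < j → ¬P k := by
  classical
  have hex : ∃ j, i < j ∧ P j := ⟨N, hiN, hN⟩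
  exact ⟨Nat.find hex, (Nat.find_spec hex).1, Nat.find_min' hex ⟨hiN, hN⟩, (Nat.find_spec hex).2,
    fun k hk hkj hP => Nat.find_min hex hkj ⟨hk, hP⟩⟩

theorem summatory_ge_of_chain_aux {f : ℕ → ℝ} (hf : IsBddComplMult f) {K ℓ η θ c E : ℝ} {N : ℕ}
    (hK : 1 < K) (hℓ : 0 < ℓ) (hη : 0 < η) (hc : 0 ≤ c) (hθ : 0 < θ) (hθ1 : θ ≤ 1)
    (hgood : θ ≤ ∑ q ∈ primesIn (Real.exp (ℓ / K ^ (N + 1))) (Real.exp (ℓ / K ^ N)), (1 + f q) / q)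
    (hE : K ^ badCount f K ℓ θ N 0 ≤ E)
    (hbase : ∀ y, Real.exp (η * (ℓ / K ^ N)) ≤ y → y ≤ Real.exp ((1 + η) * (ℓ / K ^ N)) →
      c * y ≤ summatory f y) (d : ℕ) :
    ∀ i, i + d = N → ∀ y, Real.exp (η * (ℓ / K ^ N)) ≤ y → y ≤ Real.exp ((1 + η) * (ℓ / K ^ i)) →
      c * Real.exp (-((1 + η) * K ^ 2 * Real.log ((1 + η) * K ^ 2 * E / θ) *
        (d + K ^ badCount f K ℓ θ N i))) * y ≤ summatory f y := by
  have hK0 : 0 < K := by linarith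
  set lam := (1 + η) * K ^ 2 with hlam
  have hlam1 : 1 ≤ lam := by
    rw [hlam]
    nlinarith
  have hE1 : 1 ≤ E := (one_le_pow₀ hK.le).trans hE
  set P := lam * Real.log (lam * E / θ) with hP
  have hP0 : 0 ≤ P := by
    refine mul_nonneg (by linarith) (Real.log_nonneg ?_)
    rw [le_div_iff₀ hθ]
    nlinarith
  induction d using Nat.strong_induction_on with
  | _ d ih =>
    intro i hi y hAy hyY
    have hA : 1 ≤ Real.exp (η * (ℓ / K ^ N)) := Real.one_le_exp (by positivity)
    have hy0 : 0 ≤ y := by linarith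
    rcases Nat.eq_zero_or_pos d with hd | hd
    · subst hd
      rw [add_zero] at hi
      subst hi
      refine le_trans ?_ (hbase y hAy hyY)
      gcongr
      refine mul_le_of_le_one_right hc (Real.exp_le_one_iff.2 ?_)
      have : 0 ≤ P * (((0 : ℕ) : ℝ) + K ^ badCount f K ℓ θ i i) := by positivity
      linarith
    obtain ⟨j, hij, hjN, hj, hbad⟩ := exists_first_good (P := fun j => θ ≤ ∑ q ∈ primesIn
      (Real.exp (ℓ / K ^ (j + 1))) (Real.exp (ℓ / K ^ j)), (1 + f q) / q) (i := i) (N := N)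
      (by omega) hgood
    have hcount := badCount_add_le hij hjN fun k h1 h2 => not_le.1 (hbad k h1 h2)
    obtain ⟨g, rfl⟩ := Nat.exists_eq_add_of_lt hij
    have hg : i + g + 1 - (i + 1) = g := by omega
    rw [hg] at hcount
    have ih' := ih (N - (i + g + 1)) (by omega) (i + g + 1) (by omega)
    set b := badCount f K ℓ θ N with hb
    have hb0 : b i ≤ b 0 := by
      refine card_le_card (filter_subset_filter _ (Ico_subset_Ico_left (Nat.zero_le i)))
    have hgE : K ^ g ≤ E := (pow_le_pow_right₀ hK.le (by omega)).trans hE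
    have hKg : 1 ≤ K ^ g := one_le_pow₀ hK.le
    have hKpos : ∀ n : ℕ, 0 < K ^ n := fun n => by positivity
    have hstep := summatory_ge_of_primesIn hf (z' := Real.exp (ℓ / K ^ (i + g + 1 + 1)))
      (z := Real.exp (ℓ / K ^ (i + g + 1))) (A := Real.exp (η * (ℓ / K ^ N)))
      (B := Real.exp (η * (ℓ / K ^ (i + g + 1)))) (Y := Real.exp ((1 + η) * (ℓ / K ^ i)))
      (R := lam * K ^ g) (θ := θ)
      (Real.one_lt_exp_iff.2 (by positivity))
      (Real.exp_le_exp.2 (div_le_div_of_nonneg_left hℓ.le (hKpos _)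
        (pow_le_pow_right₀ hK.le (by omega))))
      hA
      (Real.exp_le_exp.2 (mul_le_mul_of_nonneg_left (div_le_div_of_nonneg_left hℓ.le (hKpos _)
        (pow_le_pow_right₀ hK.le (by omega))) hη.le))
      (mul_nonneg hc (Real.exp_nonneg _)) hθ hj (by nlinarith)
      (by
        rw [Real.log_exp, Real.log_exp, hlam]
        refine le_of_eq ?_
        field_simp
        ring)
      (fun y h1 h2 => ih' y h1 (h2.trans_eq (by rw [← Real.exp_add]; congr 1; ring)))
      hAy hyY
    refine le_trans ?_ hstep
    rw [mul_assoc c (Real.exp _) (Real.exp _), ← Real.exp_add]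
    gcongr
    have hlog : lam * K ^ g * Real.log (lam * K ^ g / θ) ≤ P * K ^ g := by
      have h1 : Real.log (lam * K ^ g / θ) ≤ Real.log (lam * E / θ) := by
        refine Real.log_le_log (by positivity) ?_
        gcongr
      calc _ ≤ lam * K ^ g * Real.log (lam * E / θ) := by gcongr
        _ = _ := by rw [hP]; ring
    have hpow : K ^ b (i + g + 1) + K ^ g ≤ 1 + K ^ b i := by
      have h1 : K ^ b (i + g + 1) * K ^ g ≤ K ^ b i := by
        rw [← pow_add]
        exact pow_le_pow_right₀ hK.le hcount
      have h2 : 1 ≤ K ^ b (i + g + 1) := one_le_pow₀ hK.le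
      nlinarith
    have hd' : ((N - (i + g + 1) : ℕ) : ℝ) + 1 ≤ d := by
      exact_mod_cast (by omega : N - (i + g + 1) + 1 ≤ d)
    have : P * (((N - (i + g + 1) : ℕ) : ℝ) + K ^ b (i + g + 1) + K ^ g) ≤ P * (d + K ^ b i) :=
      mul_le_mul_of_nonneg_left (by linarith) hP0
    linarith

theorem summatory_ge_of_chain {f : ℕ → ℝ} (hf : IsBddComplMult f) {K ℓ η θ c E : ℝ} {N : ℕ}
    (hK : 1 < K) (hℓ : 0 < ℓ) (hη : 0 < η) (hη1 : η ≤ 1) (hc : 0 ≤ c) (hθ : 0 < θ) (hθ1 : θ ≤ 1)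
    (hgood : θ ≤ ∑ q ∈ primesIn (Real.exp (ℓ / K ^ (N + 1))) (Real.exp (ℓ / K ^ N)), (1 + f q) / q)
    (hE : K ^ badCount f K ℓ θ N 0 ≤ E)
    (hbase : ∀ y, Real.exp (η * (ℓ / K ^ N)) ≤ y → y ≤ Real.exp ((1 + η) * (ℓ / K ^ N)) →
      c * y ≤ summatory f y) :
    c * Real.exp (-((1 + η) * K ^ 2 * Real.log ((1 + η) * K ^ 2 * E / θ) * (N + E))) *
      Real.exp ℓ ≤ summatory f (Real.exp ℓ) := by
  have hKN : 1 ≤ K ^ N := one_le_pow₀ hK.le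
  have h := summatory_ge_of_chain_aux hf hK hℓ hη hc hθ hθ1 hgood hE hbase N 0 (zero_add N)
    (Real.exp ℓ) (Real.exp_le_exp.2 ?_) (Real.exp_le_exp.2 ?_)
  · refine le_trans ?_ h
    have hE1 : 1 ≤ E := (one_le_pow₀ hK.le).trans hE
    have : 0 ≤ Real.log ((1 + η) * K ^ 2 * E / θ) := by
      refine Real.log_nonneg ?_
      rw [le_div_iff₀ hθ]
      have h1 : 1 ≤ (1 + η) * K ^ 2 := by nlinarith
      nlinarith
    gcongr
  · have : ℓ / K ^ N ≤ ℓ := div_le_self hℓ.le hKN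
    have h0 : 0 ≤ ℓ / K ^ N := by positivity
    nlinarith
  · rw [pow_zero, div_one]
    nlinarith

theorem exists_exponent_le {D S κ : ℝ} (hD : 0 ≤ D) (hS : 0 ≤ S) (hκ : 0 < κ) :
    ∃ C : ℝ, ∀ u N : ℝ, 0 ≤ u → 0 ≤ N → N ≤ S * u →
      D * u + (1 + 1 / 100) * (11 / 10) ^ 2 * Real.log ((1 + 1 / 100) * (11 / 10) ^ 2 *
        Real.exp (u / 2 + 1 / 100) / (κ / (u + 1))) * (N + Real.exp (u / 2 + 1 / 100)) ≤
        u * Real.exp (u / 2) + C := by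
  set A := |Real.log ((1 + 1 / 100) * (11 / 10) ^ 2 / κ)| + 3 with hA
  have hA0 : 0 ≤ A := by positivity
  set B := D * 4 + (3 / 4 + 1.3 * A) * S * 16 + 1.3 * A * 1.02 with hB
  have hB0 : 0 ≤ B := by positivity
  refine ⟨B * Real.exp (2 * B), fun u N hu hN hNS => ?_⟩
  set e := Real.exp (u / 2) with he
  have he1 : 1 ≤ e := Real.one_le_exp (by positivity)
  have hexp : Real.exp (u / 2 + 1 / 100) ≤ 1.02 * e := by
    rw [Real.exp_add, mul_comm]
    gcongr
    have := Real.exp_bound_div_one_sub_of_interval (x := 1 / 100) (by norm_num) (by norm_num)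
    norm_num at this ⊢
    linarith
  have hlogu : Real.log (u + 1) ≤ u / 10 + 2.4 := by
    have h1 := Real.log_le_sub_one_of_pos (x := (u + 1) / 10) (by positivity)
    rw [Real.log_div (by positivity) (by norm_num)] at h1
    have h2 : Real.log 10 ≤ 3 := by
      have h4 : Real.log 10 ≤ Real.log (2 ^ 4) := Real.log_le_log (by norm_num) (by norm_num)
      rw [Real.log_pow] at h4
      push_cast at h4
      linarith [Real.log_two_lt_d9]
    linarith
  have hlog : Real.log ((1 + 1 / 100) * (11 / 10) ^ 2 * Real.exp (u / 2 + 1 / 100) / (κ / (u + 1)))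
      ≤ 0.6 * u + A := by
    have h1 : (1 + 1 / 100) * (11 / 10) ^ 2 * Real.exp (u / 2 + 1 / 100) / (κ / (u + 1)) =
        (1 + 1 / 100) * (11 / 10) ^ 2 / κ * Real.exp (u / 2 + 1 / 100) * (u + 1) := by
      field_simp
    rw [h1, Real.log_mul (by positivity) (by positivity), Real.log_mul (by positivity)
      (by positivity), Real.log_exp]
    have := le_abs_self (Real.log ((1 + 1 / 100) * (11 / 10) ^ 2 / κ))
    linarith
  have hu4 : u + 1 ≤ 4 * Real.exp (u / 4) := by linarith [Real.add_one_le_exp (u / 4)]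
  have hu2 : (u + 1) ^ 2 ≤ 16 * e := by
    have h1 : Real.exp (u / 4) ^ 2 = e := by
      rw [← Real.exp_nat_mul, he]
      congr 1
      push_cast
      ring
    have h2 := pow_le_pow_left₀ (by positivity) hu4 2
    rw [mul_pow, h1] at h2
    linarith
  have hu1 : u ≤ 4 * e := by
    have : Real.exp (u / 4) ≤ e := Real.exp_le_exp.2 (by linarith)
    linarith
  have hmain : D * u + (1 + 1 / 100) * (11 / 10) ^ 2 * Real.log ((1 + 1 / 100) * (11 / 10) ^ 2 *
      Real.exp (u / 2 + 1 / 100) / (κ / (u + 1))) * (N + Real.exp (u / 2 + 1 / 100)) ≤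
      3 / 4 * u * e + B * e := by
    have h1 : (1 + 1 / 100) * (11 / 10) ^ 2 * Real.log ((1 + 1 / 100) * (11 / 10) ^ 2 *
        Real.exp (u / 2 + 1 / 100) / (κ / (u + 1))) ≤ 0.734 * u + 1.3 * A := by
      calc _ ≤ (1 + 1 / 100) * (11 / 10) ^ 2 * (0.6 * u + A) := by gcongr
        _ ≤ _ := by
          norm_num
          nlinarith
    have h2 : N + Real.exp (u / 2 + 1 / 100) ≤ S * u + 1.02 * e := by linarith
    have h3 : (0.734 * u + 1.3 * A) * (S * u) ≤ (3 / 4 + 1.3 * A) * S * (16 * e) := by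
      calc (0.734 * u + 1.3 * A) * (S * u) ≤ ((3 / 4 + 1.3 * A) * (u + 1)) * (S * (u + 1)) := by
            gcongr
            · nlinarith [mul_nonneg hA0 hu]
            · linarith
        _ = (3 / 4 + 1.3 * A) * S * (u + 1) ^ 2 := by ring
        _ ≤ _ := by gcongr
    have h4 : D * u ≤ D * (4 * e) := by gcongr
    calc _ ≤ D * u + (0.734 * u + 1.3 * A) * (S * u + 1.02 * e) := by
          gcongr
      _ ≤ 3 / 4 * u * e + B * e := by
          have h5 : 0 ≤ u * e := by positivity
          rw [hB]
          nlinarith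
  refine hmain.trans ?_
  rcases le_total (4 * B) u with h | h
  · have h5 : 0 ≤ B * Real.exp (2 * B) := by positivity
    nlinarith
  · have h5 : e ≤ Real.exp (2 * B) := Real.exp_le_exp.2 (by linarith)
    have h6 : B * e ≤ B * Real.exp (2 * B) := by gcongr
    have h7 : 0 ≤ u * e := by positivity
    nlinarith

theorem one_sub_div_nonneg {f : ℕ → ℝ} (hf : IsBddComplMult f) {p : ℕ} (hp : p.Prime) :
    0 ≤ (1 - f p) / p :=
  div_nonneg (by linarith [hf.le_one p hp.pos]) p.cast_nonneg

theorem sum_primesIn_one_sub_mono {f : ℕ → ℝ} (hf : IsBddComplMult f) {a b c d : ℝ} (hca : c ≤ a)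
    (hbd : b ≤ d) : ∑ p ∈ primesIn a b, (1 - f p) / p ≤ ∑ p ∈ primesIn c d, (1 - f p) / p :=
  sum_le_sum_of_subset_of_nonneg (primesIn_subset hca hbd) fun _ hp _ =>
    one_sub_div_nonneg hf (mem_primesIn.1 hp).1

theorem sum_primesIn_one_add_eq (f : ℕ → ℝ) (a b : ℝ) :
    ∑ q ∈ primesIn a b, (1 + f q) / q =
      2 * ∑ q ∈ primesIn a b, 1 / (q : ℝ) - ∑ q ∈ primesIn a b, (1 - f q) / q := by
  rw [mul_sum, ← sum_sub_distrib]
  exact sum_congr rfl fun q _ => by ring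

theorem antitone_exp_div_pow {K ℓ : ℝ} (hK : 1 < K) (hℓ : 0 ≤ ℓ) :
    Antitone fun j : ℕ => Real.exp (ℓ / K ^ j) := fun i j hij =>
  Real.exp_le_exp.2 (div_le_div_of_nonneg_left hℓ (by positivity) (pow_le_pow_right₀ hK.le hij))

theorem exists_block_le {f : ℕ → ℝ} (hf : IsBddComplMult f) {K ℓ ε : ℝ} (hK : 1 < K) (hℓ : 0 ≤ ℓ)
    (hε : 0 < ε) (m : ℕ) :
    ∃ k : ℕ, k * ε ≤ ∑ p ∈ primesIn 1 (Real.exp ℓ), (1 - f p) / p ∧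
      ∑ p ∈ primesIn (Real.exp (ℓ / K ^ (m * k + m))) (Real.exp (ℓ / K ^ (m * k))),
        (1 - f p) / p ≤ ε := by
  set u := ∑ p ∈ primesIn 1 (Real.exp ℓ), (1 - f p) / p with hu
  have hu0 : 0 ≤ u := sum_nonneg fun p hp => one_sub_div_nonneg hf (mem_primesIn.1 hp).1
  by_contra! h
  have hanti : Antitone fun k : ℕ => Real.exp (ℓ / K ^ (m * k)) := fun i j hij =>
    antitone_exp_div_pow hK hℓ (Nat.mul_le_mul_left m hij)
  have h1 := sum_range_sum_primesIn hanti (⌊u / ε⌋₊ + 1) fun p => (1 - f p) / p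
  have h2 : ((⌊u / ε⌋₊ : ℝ) + 1) * ε ≤ ∑ k ∈ range (⌊u / ε⌋₊ + 1),
      ∑ p ∈ primesIn (Real.exp (ℓ / K ^ (m * (k + 1)))) (Real.exp (ℓ / K ^ (m * k))),
        (1 - f p) / p := by
    calc _ = ∑ k ∈ range (⌊u / ε⌋₊ + 1), ε := by simp
      _ ≤ _ := by
        refine sum_le_sum fun k hk => ?_
        rw [Nat.mul_succ]
        refine (h k ?_).le
        have h3 : (k : ℝ) ≤ u / ε := (Nat.le_floor_iff (by positivity)).1
          (Nat.lt_succ_iff.1 (mem_range.1 hk))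
        exact (le_div_iff₀ hε).1 h3
  rw [h1] at h2
  have h3 : ∑ p ∈ primesIn (Real.exp (ℓ / K ^ (m * (⌊u / ε⌋₊ + 1))))
      (Real.exp (ℓ / K ^ (m * 0))), (1 - f p) / p ≤ u :=
    sum_primesIn_one_sub_mono hf (Real.one_le_exp (by positivity)) (by simp)
  have h4 := (div_lt_iff₀ hε).1 (Nat.lt_floor_add_one (u / ε))
  linarith

theorem badCount_mul_le {f : ℕ → ℝ} (hf : IsBddComplMult f) {K ℓ θ : ℝ} {N : ℕ} (hK : 1 < K)
    (hℓ : 0 ≤ ℓ)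
    (h : ∀ j < N, Real.log K - θ / 2 ≤
      ∑ q ∈ primesIn (Real.exp (ℓ / K ^ (j + 1))) (Real.exp (ℓ / K ^ j)), 1 / (q : ℝ)) :
    badCount f K ℓ θ N 0 * (2 * Real.log K - 2 * θ) ≤
      ∑ p ∈ primesIn 1 (Real.exp ℓ), (1 - f p) / p := by
  have h1 := sum_range_sum_primesIn (antitone_exp_div_pow hK hℓ) N fun p => (1 - f p) / p
  rw [badCount, ← nsmul_eq_mul, ← sum_const]
  calc _ ≤ ∑ j ∈ Ico 0 N with ∑ q ∈ primesIn (Real.exp (ℓ / K ^ (j + 1))) (Real.exp (ℓ / K ^ j)),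
        (1 + f q) / q < θ, ∑ p ∈ primesIn (Real.exp (ℓ / K ^ (j + 1))) (Real.exp (ℓ / K ^ j)),
          (1 - f p) / p := by
        refine sum_le_sum fun j hj => ?_
        simp only [mem_filter, mem_Ico] at hj
        have h2 := h j hj.1.2
        have h3 := hj.2
        rw [sum_primesIn_one_add_eq] at h3
        linarith
    _ ≤ ∑ j ∈ range N, ∑ p ∈ primesIn (Real.exp (ℓ / K ^ (j + 1))) (Real.exp (ℓ / K ^ j)),
          (1 - f p) / p := by
        rw [range_eq_Ico]
        exact sum_le_sum_of_subset_of_nonneg (filter_subset _ _) fun j _ _ =>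
          sum_nonneg fun p hp => one_sub_div_nonneg hf (mem_primesIn.1 hp).1
    _ ≤ _ := by
        rw [h1]
        exact sum_primesIn_one_sub_mono hf (Real.one_le_exp (by positivity)) (by simp)

theorem exists_mul_le_summatory_of_block :
    ∃ c ε ℓ₀ : ℝ, 0 < c ∧ 0 < ε ∧ ∀ f : ℕ → ℝ, IsBddComplMult f → ∀ L U : ℝ, 0 < L → ℓ₀ ≤ L →
      ∑ p ∈ primesIn (Real.exp (L / 10 ^ 4)) (Real.exp L), (1 - f p) / p ≤ ε →
      ∑ p ∈ primesIn 1 (Real.exp L), (1 - f p) / p ≤ U →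
      ∀ y, Real.exp (1 / 100 * L) ≤ y → y ≤ Real.exp ((1 + 1 / 100) * L) →
        c * L * Real.exp (-U) * y ≤ summatory f y := by
  obtain ⟨ε, ℓ₀, hε, h5⟩ := exists_mul_logSummatory_le_summatory (η := 1 / 100) (by norm_num)
    (by norm_num)
  obtain ⟨C, h4⟩ := exists_log_sq_le_logSummatory
  refine ⟨Real.exp (-C) / (200 ^ 2 * 4 * 32 * 1.01), ε, 100 * ℓ₀, by positivity, hε,
    fun f hf L U hL hL0 hblock hU y hy hy' => ?_⟩
  have hy1 : 1 ≤ y := (Real.one_le_exp (by positivity)).trans hy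
  have hy0 : 0 < y := by linarith
  have hlog : 1 / 100 * L ≤ Real.log y := (Real.le_log_iff_exp_le hy0).2 hy
  have hlog' : Real.log y ≤ (1 + 1 / 100) * L := (Real.log_le_iff_le_exp hy0).2 hy'
  have h1 := h5 f hf y hy1 (by linarith) (le_trans (sum_primesIn_one_sub_mono hf ?_ ?_) hblock)
  · have h2 := h4 f hf (Real.exp (L / 200)) (Real.one_le_exp (by positivity))
    rw [Real.log_exp] at h2
    have h3 : Real.exp (L / 200) ≤ √y := by
      refine Real.le_sqrt_of_sq_le (le_trans (le_of_eq ?_) hy)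
      rw [← Real.exp_nat_mul]
      congr 1
      push_cast
      ring
    have h6 := logSummatory_mono hf h3
    have h7 : ∑ p ∈ primesIn 1 (Real.exp (L / 200)), (1 - f p) / p ≤ U :=
      (sum_primesIn_one_sub_mono hf le_rfl (Real.exp_le_exp.2 (by linarith))).trans hU
    have h8 : (L / 200) ^ 2 / 4 ≤ logSummatory f (√y) * Real.exp (U + C) := by
      refine h2.trans ?_
      have := logSummatory_nonneg hf (√y)
      gcongr
    have h9 : (L / 200) ^ 2 / 4 * Real.exp (-(U + C)) ≤ logSummatory f (√y) := by
      rw [Real.exp_neg, ← div_eq_mul_inv, div_le_iff₀ (Real.exp_pos _)]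
      exact h8
    have h10 : y * ((L / 200) ^ 2 / 4 * Real.exp (-(U + C))) / 32 ≤
        summatory f y * ((1 + 1 / 100) * L) := by
      have h11 : y * ((L / 200) ^ 2 / 4 * Real.exp (-(U + C))) / 32 ≤
          y * logSummatory f (√y) / 32 := by gcongr
      exact (h11.trans h1).trans (mul_le_mul_of_nonneg_left hlog' (summatory_nonneg hf y))
    refine le_of_mul_le_mul_right (le_trans (le_of_eq ?_) h10)
      (by positivity : 0 < (1 + 1 / 100) * L)
    rw [neg_add, Real.exp_add]
    ring
  · rw [Real.rpow_def_of_pos hy0]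
    exact Real.exp_le_exp.2 (by linarith)
  · rw [Real.rpow_def_of_pos hy0]
    exact Real.exp_le_exp.2 (by nlinarith)

theorem log_eleven_div_ten_mem : 9 / 100 ≤ Real.log (11 / 10) ∧ Real.log (11 / 10) ≤ 1 / 10 := by
  have h1 := Real.one_sub_inv_le_log_of_pos (x := 11 / 10) (by norm_num)
  have h2 := Real.log_le_sub_one_of_pos (x := 11 / 10) (by norm_num)
  norm_num at h1 h2
  exact ⟨by linarith, by linarith⟩

theorem pow_le_exp_of_mul_log_le {K θ u : ℝ} {b : ℕ} (hK : 0 < K) (hu : 0 ≤ u)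
    (hKθ : Real.log K = 100 * (θ * (u + 1))) (h : b * (2 * Real.log K - 2 * θ) ≤ u) :
    K ^ b ≤ Real.exp (u / 2 + 1 / 100) := by
  rw [← Real.exp_log (pow_pos hK b), Real.log_pow]
  refine Real.exp_le_exp.2 ?_
  rw [hKθ] at h ⊢
  have h3 : b * θ * (200 * (u + 1) - 2) ≤ u := by linarith
  have h4 : b * θ ≤ u / (200 * (u + 1) - 2) := (le_div_iff₀ (by linarith)).2 h3
  have h5 : u / (200 * (u + 1) - 2) * (100 * (u + 1)) ≤ u / 2 + 1 / 100 := by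
    rw [div_mul_eq_mul_div, div_le_iff₀ (by linarith)]
    nlinarith
  have h6 : b * θ * (100 * (u + 1)) ≤ u / (200 * (u + 1) - 2) * (100 * (u + 1)) := by gcongr
  linarith

theorem le_sum_primesIn_exp_div_pow {C : ℝ}
    (hmer : ∀ z w : ℝ, 1 < z → z ≤ w → Real.log (Real.log w) - Real.log (Real.log z) -
      C / Real.log z ≤ ∑ p ∈ primesIn z w, 1 / (p : ℝ))
    {K ℓ : ℝ} (hK : 1 < K) (hℓ : 0 < ℓ) (j : ℕ) :
    Real.log K - C / (ℓ / K ^ (j + 1)) ≤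
      ∑ q ∈ primesIn (Real.exp (ℓ / K ^ (j + 1))) (Real.exp (ℓ / K ^ j)), 1 / (q : ℝ) := by
  have hK0 : 0 < K := by linarith
  refine le_trans ?_ (hmer _ _ (Real.one_lt_exp_iff.2 (by positivity))
    (antitone_exp_div_pow hK hℓ.le j.le_succ))
  rw [Real.log_exp, Real.log_exp, Real.log_div hℓ.ne' (by positivity),
    Real.log_div hℓ.ne' (by positivity), Real.log_pow, Real.log_pow]
  push_cast
  linarith

theorem exists_mul_exp_le_summatory :
    ∃ c W D : ℝ, 0 < c ∧ 0 < W ∧ 0 < D ∧ ∀ f : ℕ → ℝ, IsBddComplMult f → ∀ ℓ u : ℝ,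
      ∑ p ∈ primesIn 1 (Real.exp ℓ), (1 - f p) / p = u → W * Real.exp (D * u) ≤ ℓ →
        c * Real.exp (-(u * Real.exp (u / 2))) * ℓ * Real.exp ℓ ≤ summatory f (Real.exp ℓ) := by
  obtain ⟨c₀, ε₀, ℓ₀, hc₀, hε₀, hbase⟩ := exists_mul_le_summatory_of_block
  obtain ⟨C₁, hC₁, hmer⟩ := exists_le_sum_primesIn_inv
  obtain ⟨hK1, hK2⟩ := log_eleven_div_ten_mem
  set ε := min ε₀ (1 / 20) with hε
  have hε0 : 0 < ε := lt_min hε₀ (by norm_num)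
  set κ := Real.log (11 / 10) / 100 with hκ
  have hκ0 : 0 < κ := by positivity
  obtain ⟨C₂, hC₂⟩ := exists_exponent_le (D := 10 / ε + 1) (S := 100 / ε) (κ := κ) (by positivity)
    (by positivity) hκ0
  refine ⟨c₀ * Real.exp (-C₂), max 1 (max ℓ₀ (2.2 * C₁ / κ)), 10 / ε + 1, by positivity,
    by positivity, by positivity, fun f hf ℓ u hu hW => ?_⟩
  set W := max 1 (max ℓ₀ (2.2 * C₁ / κ)) with hWdef
  have hW1 : 1 ≤ W := le_max_left _ _
  have hW2 : ℓ₀ ≤ W := (le_max_left _ _).trans (le_max_right _ _)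
  have hW3 : 2.2 * C₁ / κ ≤ W := (le_max_right _ _).trans (le_max_right _ _)
  have hu0 : 0 ≤ u := hu ▸ sum_nonneg fun p hp => one_sub_div_nonneg hf (mem_primesIn.1 hp).1
  have hℓ0 : 0 < ℓ := lt_of_lt_of_le (by positivity) hW
  obtain ⟨k, hk1, hk2⟩ := exists_block_le (K := 11 / 10) hf (by norm_num) hℓ0.le hε0 100
  rw [hu] at hk1
  set N := 100 * k with hN
  have hNu : (N : ℝ) ≤ 100 / ε * u := by
    rw [hN]
    push_cast
    rw [div_mul_eq_mul_div, le_div_iff₀ hε0]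
    linarith
  have hKN : ((11 : ℝ) / 10) ^ N ≤ Real.exp (10 / ε * u) := by
    rw [← Real.exp_log (x := (11 : ℝ) / 10) (by norm_num), ← Real.exp_nat_mul]
    refine Real.exp_le_exp.2 ?_
    calc (N : ℝ) * Real.log (11 / 10) ≤ 100 / ε * u * (1 / 10) := by gcongr
      _ = _ := by ring
  have hKN0 : (0 : ℝ) < (11 / 10) ^ N := by positivity
  set L := ℓ / (11 / 10) ^ N with hL
  have hL0 : 0 < L := by positivity
  have hLℓ : L ≤ ℓ := div_le_self hℓ0.le (one_le_pow₀ (by norm_num))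
  have hWL : W * (u + 1) ≤ L := by
    rw [hL, le_div_iff₀ hKN0]
    refine le_trans ?_ hW
    have h1 : u + 1 ≤ Real.exp u := Real.add_one_le_exp u
    calc W * (u + 1) * (11 / 10) ^ N ≤ W * Real.exp u * Real.exp (10 / ε * u) := by gcongr
      _ = _ := by
        rw [mul_assoc, ← Real.exp_add]
        ring_nf
  have hWL' : W ≤ L := by nlinarith
  have hLexp : ℓ * Real.exp (-(10 / ε * u)) ≤ L := by
    rw [hL, Real.exp_neg, ← div_eq_mul_inv]
    gcongr
  set θ := κ / (u + 1) with hθ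
  have hθ0 : 0 < θ := by positivity
  have hθκ : θ ≤ κ := div_le_self hκ0.le (by linarith)
  have hθu : θ * (u + 1) = κ := by
    rw [hθ]
    field_simp
  have hwin : ∀ j ≤ N, Real.log (11 / 10) - θ / 2 ≤
      ∑ q ∈ primesIn (Real.exp (ℓ / (11 / 10) ^ (j + 1))) (Real.exp (ℓ / (11 / 10) ^ j)),
        1 / (q : ℝ) := by
    intro j hj
    refine le_trans ?_ (le_sum_primesIn_exp_div_pow hmer (K := 11 / 10) (by norm_num) hℓ0 j)
    have h2 : L / (11 / 10) ≤ ℓ / (11 / 10) ^ (j + 1) := by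
      rw [hL, div_div, ← pow_succ]
      gcongr
      norm_num
    have h3 : C₁ / (ℓ / (11 / 10) ^ (j + 1)) ≤ θ / 2 := by
      rw [div_le_iff₀ (by positivity)]
      have h4 : 2.2 * C₁ ≤ W * κ := (div_le_iff₀ hκ0).1 hW3
      have h5 : W * κ ≤ θ * L := by
        rw [← hθu]
        nlinarith
      nlinarith
    linarith
  have hlast : ∑ p ∈ primesIn (Real.exp (L / 10 ^ 4)) (Real.exp L), (1 - f p) / p ≤ ε := by
    refine le_trans (sum_primesIn_one_sub_mono hf (Real.exp_le_exp.2 ?_) le_rfl) hk2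
    rw [pow_add, ← div_div]
    gcongr
    norm_num
  have hbad : ((11 : ℝ) / 10) ^ badCount f (11 / 10) ℓ θ N 0 ≤ Real.exp (u / 2 + 1 / 100) := by
    have h1 := badCount_mul_le hf (K := 11 / 10) (by norm_num) hℓ0.le fun j hj => hwin j hj.le
    rw [hu] at h1
    exact pow_le_exp_of_mul_log_le (by norm_num) hu0 (by rw [hθu, hκ]; ring) h1
  have hgood : θ ≤ ∑ q ∈ primesIn (Real.exp (ℓ / (11 / 10) ^ (N + 1)))
      (Real.exp (ℓ / (11 / 10) ^ N)), (1 + f q) / q := by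
    rw [sum_primesIn_one_add_eq]
    have h1 := hwin N le_rfl
    have h2 : ∑ q ∈ primesIn (Real.exp (ℓ / (11 / 10) ^ (N + 1)))
        (Real.exp (ℓ / (11 / 10) ^ N)), (1 - f q) / q ≤ ε :=
      (sum_primesIn_one_sub_mono hf (antitone_exp_div_pow (K := 11 / 10) (by norm_num) hℓ0.le
        (by omega)) le_rfl).trans hk2
    have h3 : ε ≤ 1 / 20 := min_le_right _ _
    linarith
  have h := summatory_ge_of_chain hf (K := 11 / 10) (η := 1 / 100) (c := c₀ * L * Real.exp (-u))
    (by norm_num) hℓ0 (by norm_num) (by norm_num) (by positivity) hθ0 (by linarith) hgood hbad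
    (hbase f hf L u hL0 (hW2.trans hWL') (hlast.trans (min_le_left _ _))
      (hu ▸ sum_primesIn_one_sub_mono hf le_rfl (Real.exp_le_exp.2 hLℓ)))
  refine le_trans (mul_le_mul_of_nonneg_right ?_ (Real.exp_pos _).le) h
  have h1 := hC₂ u N hu0 N.cast_nonneg hNu
  set X := (1 + 1 / 100) * (11 / 10) ^ 2 * Real.log ((1 + 1 / 100) * (11 / 10) ^ 2 *
    Real.exp (u / 2 + 1 / 100) / θ) * (N + Real.exp (u / 2 + 1 / 100)) with hX
  calc c₀ * Real.exp (-C₂) * Real.exp (-(u * Real.exp (u / 2))) * ℓ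
      = c₀ * ℓ * Real.exp (-C₂ + -(u * Real.exp (u / 2))) := by
        rw [Real.exp_add]
        ring
    _ ≤ c₀ * ℓ * Real.exp (-(10 / ε * u) + -u + -X) := by
        refine mul_le_mul_of_nonneg_left (Real.exp_le_exp.2 ?_) (by positivity)
        linarith
    _ = c₀ * (ℓ * Real.exp (-(10 / ε * u))) * Real.exp (-u) * Real.exp (-X) := by
        rw [Real.exp_add, Real.exp_add]
        ring
    _ ≤ c₀ * L * Real.exp (-u) * Real.exp (-X) := by gcongr

theorem exists_mul_exp_neg_le {W D : ℝ} (hW : 0 < W) (hD : 0 < D) :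
    ∃ β ℓ₁ : ℝ, 0 < β ∧ 0 < ℓ₁ ∧ ∀ ℓ u : ℝ, ℓ₁ ≤ ℓ → ℓ ≤ W * Real.exp (D * u) →
      Real.exp (-(u * Real.exp (u / 2))) * ℓ ≤ Real.exp (-ℓ ^ β) := by
  set β := 1 / (4 * D) with hβ
  have hβ0 : 0 < β := by positivity
  have h1 : ∀ᶠ ℓ : ℝ in Filter.atTop, Real.log ℓ ≤ ℓ ^ β := by
    filter_upwards [(isLittleO_log_rpow_atTop hβ0).bound one_pos, Filter.eventually_ge_atTop 1]
      with ℓ h h'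
    rw [one_mul] at h
    exact (le_abs_self _).trans (h.trans_eq (abs_of_nonneg (by positivity)))
  have h2 : ∀ᶠ ℓ : ℝ in Filter.atTop, 2 * W ^ (2 * β) ≤ ℓ ^ β :=
    (tendsto_rpow_atTop hβ0).eventually_ge_atTop _
  obtain ⟨ℓ₁, hℓ₁⟩ := Filter.eventually_atTop.1 (h1.and (h2.and
    (Filter.eventually_ge_atTop (W * Real.exp D))))
  refine ⟨β, max ℓ₁ 1, hβ0, by positivity, fun ℓ u hℓ hu => ?_⟩
  obtain ⟨h3, h4, h5⟩ := hℓ₁ ℓ ((le_max_left _ _).trans hℓ)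
  have hℓ0 : 0 < ℓ := one_pos.trans_le ((le_max_right _ _).trans hℓ)
  have hu1 : 1 ≤ u := by
    have h6 := le_of_mul_le_mul_left (h5.trans hu) hW
    rw [Real.exp_le_exp] at h6
    exact le_of_mul_le_mul_left (by linarith) hD
  have h6 : ℓ ^ (2 * β) ≤ W ^ (2 * β) * Real.exp (u / 2) := by
    calc ℓ ^ (2 * β) ≤ (W * Real.exp (D * u)) ^ (2 * β) := by gcongr
      _ = _ := by
        rw [Real.mul_rpow hW.le (Real.exp_pos _).le, ← Real.exp_mul]
        congr 2
        rw [hβ]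
        field_simp
        ring
  have h7 : 2 * ℓ ^ β ≤ Real.exp (u / 2) := by
    have h8 : 0 < W ^ (2 * β) := by positivity
    refine le_of_mul_le_mul_left ?_ h8
    refine le_trans ?_ h6
    rw [two_mul β, Real.rpow_add hℓ0, ← two_mul]
    nlinarith [Real.rpow_pos_of_pos hℓ0 β]
  calc Real.exp (-(u * Real.exp (u / 2))) * ℓ
      = Real.exp (-(u * Real.exp (u / 2)) + Real.log ℓ) := by
        rw [Real.exp_add, Real.exp_log hℓ0]
    _ ≤ _ := by
        refine Real.exp_le_exp.2 ?_
        nlinarith [Real.exp_pos (u / 2)]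

end DivisorSumMean

/-- estimate (3.5): with `g n = ∑_{d ∣ n} f d` and
`u = ∑_{p ≤ x} (1 - f p)/p`,
`(1/x) ∑_{n ≤ x} g n ≥ c e^{-u e^{u/2}} log x - C exp(-(log x)^β)`. -/
theorem divisor_sum_mean_lower_bound :
    ∃ c β C x₀ : ℝ, 0 < c ∧ 0 < β ∧ ∀ x : ℝ, x₀ ≤ x →
      ∀ f : ℕ → ℝ, IsComplMult f → (∀ n : ℕ, 0 < n → -1 ≤ f n ∧ f n ≤ 1) →
        c * Real.exp (-((∑ p ∈ (Finset.Icc 1 ⌊x⌋₊).filter Nat.Prime, (1 - f p) / p) *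
              Real.exp ((∑ p ∈ (Finset.Icc 1 ⌊x⌋₊).filter Nat.Prime, (1 - f p) / p) / 2)))
            * Real.log x
          - C * Real.exp (-(Real.log x) ^ β)
        ≤ (1 / x) * ∑ n ∈ Finset.Icc 1 ⌊x⌋₊, (∑ d ∈ n.divisors, f d) := by
  obtain ⟨c, W, D, hc, hW, hD, hlarge⟩ := DivisorSumMean.exists_mul_exp_le_summatory
  obtain ⟨β, ℓ₁, hβ, hℓ₁, hsmall⟩ := DivisorSumMean.exists_mul_exp_neg_le hW hD
  refine ⟨c, β, c, Real.exp ℓ₁, hc, hβ, fun x hx f hf hf' => ?_⟩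
  have hf₀ : DivisorSumMean.IsBddComplMult f :=
    ⟨hf.1, hf.2, fun n hn => (hf' n hn).1, fun n hn => (hf' n hn).2⟩
  have hx0 : 0 < x := (Real.exp_pos _).trans_le hx
  have hlog : ℓ₁ ≤ Real.log x := (Real.le_log_iff_exp_le hx0).2 hx
  rw [DivisorSumMean.filter_prime_eq_primesIn]
  set u := ∑ p ∈ DivisorSumMean.primesIn 1 x, (1 - f p) / p with hu
  change _ ≤ 1 / x * DivisorSumMean.summatory f x
  rcases le_total (W * Real.exp (D * u)) (Real.log x) with h | h
  · have h1 := hlarge f hf₀ (Real.log x) u (by rw [Real.exp_log hx0]) h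
    rw [Real.exp_log hx0] at h1
    rw [one_div_mul_eq_div, le_div_iff₀ hx0]
    refine le_trans (mul_le_mul_of_nonneg_right ?_ hx0.le) h1
    exact sub_le_self _ (by positivity)
  · have h1 := mul_le_mul_of_nonneg_left (hsmall (Real.log x) u hlog h) hc.le
    have h2 : 0 ≤ 1 / x * DivisorSumMean.summatory f x :=
      mul_nonneg (by positivity) (DivisorSumMean.summatory_nonneg hf₀ x)
    linarith
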